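/- arXiv:2511.10511 — 3 statements merged into one kernel-verified Lean document; each statement's English description precedes it below -/
import Mathlib

section
/- For every k ≥ 3 and every n ≥ 1, the superalgebra N_k with the trivial grading satisfies c_n^{gr,z}(N_k) = 1 + Σ_{i=2}^{k−2} C(n,i)·(i−1) and δ_n^{gr}(N_k) = (k−2)·C(n,k−1), where C(n,i) denotes the binomial coefficient. -/
noncomputable section

/-- The free superalgebra `F⟨Y,Z⟩`: the free unital associative `F`-algebra on the
even variables `Sum.inl i` (representing `y_{i+1}`) and the odd variables
`Sum.inr j` (representing `z_{j+1}`). -/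
abbrev FA (F : Type) [Field F] : Type := FreeAlgebra F (ℕ ⊕ ℕ)

variable (F : Type) [Field F]

/-- the even variable `y_{i+1}` -/
def yv (i : ℕ) : FA F := FreeAlgebra.ι F (Sum.inl i)

/-- the odd variable `z_{j+1}` -/
def zv (j : ℕ) : FA F := FreeAlgebra.ι F (Sum.inr j)

/-- the constant term of an element of `F⟨Y,Z⟩` -/
def constTerm : FA F →ₐ[F] F := FreeAlgebra.lift F (fun _ => (0 : F))

/-- the commutator `[a,b] = ab - ba` -/
def brk {R : Type} [Ring R] (a b : R) : R := a * b - b * a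

/-- the left-normed commutator `[a, l₁, l₂, …]` -/
def lnc {R : Type} [Ring R] (a : R) (l : List R) : R := l.foldl brk a

section SuperAlg

variable (B : Type) [Ring B] [Algebra F B]

/-- the center of the (possibly non-unital) subalgebra of `B` whose underlying
subspace is `S`, as a submodule of `B` -/
def centerIn (S : Submodule F B) : Submodule F B where
  carrier := {x | x ∈ S ∧ ∀ y ∈ S, x * y = y * x}
  add_mem' := by
    rintro a b ⟨ha, ha'⟩ ⟨hb, hb'⟩
    exact ⟨S.add_mem ha hb, fun y hy => by rw [add_mul, mul_add, ha' y hy, hb' y hy]⟩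
  zero_mem' := ⟨S.zero_mem, fun y _ => by rw [zero_mul, mul_zero]⟩
  smul_mem' := by
    rintro c a ⟨ha, ha'⟩
    exact ⟨S.smul_mem c ha, fun y hy => by rw [smul_mul_assoc, mul_smul_comm, ha' y hy]⟩

variable (A0 A1 : Submodule F B)

/-- a graded substitution: an algebra evaluation sending each `yᵢ` into the even
component `A0` and each `zⱼ` into the odd component `A1` -/
def IsGSubst (φ : FA F →ₐ[F] B) : Prop :=
  (∀ i, φ (yv F i) ∈ A0) ∧ (∀ j, φ (zv F j) ∈ A1)

/-- the graded identities of the superalgebra with even part `A0` and odd part `A1` -/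
def IdGr : Submodule F (FA F) where
  carrier := {f | ∀ φ : FA F →ₐ[F] B, IsGSubst F B A0 A1 φ → φ f = 0}
  add_mem' := by
    intro f g hf hg φ hφ
    rw [map_add, hf φ hφ, hg φ hφ, add_zero]
  zero_mem' := fun φ _ => map_zero φ
  smul_mem' := by
    intro c f hf φ hφ
    rw [map_smul, hf φ hφ, smul_zero]

/-- the central graded polynomials of the superalgebra with even part `A0` and
odd part `A1`: the polynomials with zero constant term all of whose graded
evaluations lie in the center of the superalgebra -/
def CGr : Submodule F (FA F) where
  carrier := {f | constTerm F f = 0 ∧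
    ∀ φ : FA F →ₐ[F] B, IsGSubst F B A0 A1 φ → φ f ∈ centerIn F B (A0 ⊔ A1)}
  add_mem' := by
    rintro f g ⟨hf0, hf⟩ ⟨hg0, hg⟩
    refine ⟨by rw [map_add, hf0, hg0, add_zero], fun φ hφ => ?_⟩
    rw [map_add]
    exact (centerIn F B (A0 ⊔ A1)).add_mem (hf φ hφ) (hg φ hφ)
  zero_mem' :=
    ⟨map_zero _, fun φ _ => by
      rw [map_zero]; exact (centerIn F B (A0 ⊔ A1)).zero_mem⟩
  smul_mem' := by
    rintro c f ⟨hf0, hf⟩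
    refine ⟨by rw [map_smul, hf0, smul_zero], fun φ hφ => ?_⟩
    rw [map_smul]
    exact (centerIn F B (A0 ⊔ A1)).smul_mem c (hf φ hφ)

end SuperAlg

/-- the space `P_n^{gr}` of multilinear graded polynomials of degree `n`,
spanned by `w_{σ(1)} ⋯ w_{σ(n)}` with `wᵢ ∈ {yᵢ, zᵢ}` -/
def PnGr (n : ℕ) : Submodule F (FA F) :=
  Submodule.span F
    {m : FA F | ∃ (σ : Equiv.Perm (Fin n)) (w : Fin n → Bool),
      m = (List.ofFn fun i : Fin n =>
        if w (σ i) then zv F (σ i).val else yv F (σ i).val).prod}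

/-- `dim P / (P ∩ C)` -/
def scodim (P C : Submodule F (FA F)) : ℕ :=
  Module.finrank F (↥P ⧸ Submodule.comap P.subtype C)

/-- `dim (P ⊓ C) / (P ⊓ I)` -/
def deltaDim (P C I : Submodule F (FA F)) : ℕ :=
  Module.finrank F (↥(P ⊓ C) ⧸ Submodule.comap (P ⊓ C).subtype (P ⊓ I))

/-- the parity automorphism of `F⟨Y,Z⟩`, fixing the `yᵢ` and negating the `zⱼ` -/
def omegaFA : FA F →ₐ[F] FA F :=
  FreeAlgebra.lift F (fun v => match v with
    | Sum.inl i => FreeAlgebra.ι F (Sum.inl i)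
    | Sum.inr j => - FreeAlgebra.ι F (Sum.inr j))

/-- an even (degree-0) element of the free superalgebra -/
def IsEvenFA (f : FA F) : Prop := omegaFA F f = f

/-- an odd (degree-1) element of the free superalgebra -/
def IsOddFA (f : FA F) : Prop := omegaFA F f = - f

/-- a graded endomorphism of the free superalgebra: sends `Y`-variables to even
elements and `Z`-variables to odd elements -/
def IsT2Endo (φ : FA F →ₐ[F] FA F) : Prop :=
  (∀ i, IsEvenFA F (φ (yv F i))) ∧ (∀ j, IsOddFA F (φ (zv F j)))

/-- a T₂-space: a subspace invariant under all graded endomorphisms -/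
def IsT2Space (V : Submodule F (FA F)) : Prop :=
  ∀ φ : FA F →ₐ[F] FA F, IsT2Endo F φ → ∀ f ∈ V, φ f ∈ V

/-- the smallest T₂-space of `F⟨Y,Z⟩` containing `S` -/
def T2SpaceGen (S : Set (FA F)) : Submodule F (FA F) :=
  sInf {V : Submodule F (FA F) | S ⊆ ↑V ∧ IsT2Space F V}

/-- a T₂-ideal: a two-sided ideal invariant under all graded endomorphisms -/
def IsT2Ideal (I : Submodule F (FA F)) : Prop :=
  (∀ f ∈ I, ∀ g : FA F, g * f ∈ I ∧ f * g ∈ I) ∧ IsT2Space F I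

/-- the smallest T₂-ideal of `F⟨Y,Z⟩` containing `S` -/
def T2IdealGen (S : Set (FA F)) : Submodule F (FA F) :=
  sInf {I : Submodule F (FA F) | S ⊆ ↑I ∧ IsT2Ideal F I}

/-- the products `z_{i₁}⋯z_{i_k} · w₁⋯w_s` where every `wⱼ` is a left-normed
commutator of weight ≥ 2 in the variables and `k + s ≥ 1`; proper
ℤ₂-polynomials are the linear combinations of these -/
def properProds : Set (FA F) :=
  {p | ∃ (zs : List ℕ) (ws : List (FA F)),
      (∀ w ∈ ws, ∃ (v : ℕ ⊕ ℕ) (l : List (ℕ ⊕ ℕ)), l ≠ [] ∧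
        w = lnc (FreeAlgebra.ι F v) (l.map (FreeAlgebra.ι F))) ∧
      1 ≤ zs.length + ws.length ∧
      p = (zs.map (zv F)).prod * ws.prod}

/-- the Jacobson radical `J(A)`, as an `F`-submodule of `A` -/
def Jrad (A : Type) [Ring A] [Algebra F A] : Submodule F A :=
  Submodule.restrictScalars F ((⊥ : Ideal A).jacobson)

/-- `J' = J(A) ∩ Z(A)` -/
def Jprime (A : Type) [Ring A] [Algebra F A] : Submodule F A :=
  Jrad F A ⊓ Subalgebra.toSubmodule (Subalgebra.center F A)

/-- the matrix unit `e_{i+1,j+1}` (0-indexed position `(i,j)`) -/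
def eMat (k i j : ℕ) : Matrix (Fin k) (Fin k) F :=
  Matrix.of fun a b => if (a : ℕ) = i ∧ (b : ℕ) = j then 1 else 0

/-- the matrix `E = e_{12} + e_{23} + ⋯ + e_{k-1,k}` -/
def EMat (k : ℕ) : Matrix (Fin k) (Fin k) F :=
  Matrix.of fun a b => if (a : ℕ) + 1 = (b : ℕ) then 1 else 0

/-- `N_k = span_F{I_k, E, …, E^{k-2}, e_{12}, …, e_{1k}}` -/
def NkSub (k : ℕ) : Submodule F (Matrix (Fin k) (Fin k) F) :=
  Submodule.span F
    ({1} ∪ {x | ∃ m, 1 ≤ m ∧ m ≤ k - 2 ∧ x = EMat F k ^ m}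
      ∪ {x | ∃ j, 1 ≤ j ∧ j ≤ k - 1 ∧ x = eMat F k 0 j})

/-- `A_k = span_F{e_{11}, E, …, E^{k-2}, e_{12}, …, e_{1k}}` -/
def AkSub (k : ℕ) : Submodule F (Matrix (Fin k) (Fin k) F) :=
  Submodule.span F
    ({eMat F k 0 0} ∪ {x | ∃ m, 1 ≤ m ∧ m ≤ k - 2 ∧ x = EMat F k ^ m}
      ∪ {x | ∃ j, 1 ≤ j ∧ j ≤ k - 1 ∧ x = eMat F k 0 j})

/-- `B_k = span_F{e_{kk}, E, …, E^{k-2}, e_{1k}, …, e_{k-1,k}}` -/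
def BkSub (k : ℕ) : Submodule F (Matrix (Fin k) (Fin k) F) :=
  Submodule.span F
    ({eMat F k (k - 1) (k - 1)} ∪ {x | ∃ m, 1 ≤ m ∧ m ≤ k - 2 ∧ x = EMat F k ^ m}
      ∪ {x | ∃ i, i ≤ k - 2 ∧ x = eMat F k i (k - 1)})

/-- the even part of `Matrix (Fin k) (Fin k) F` under the elementary ℤ₂-grading
induced by `(0,1,…,1)`: matrices vanishing at the odd positions `(i,j)`
(those where exactly one of `i`, `j` equals the first index) -/
def matEvenPart (k : ℕ) : Submodule F (Matrix (Fin k) (Fin k) F) where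
  carrier := {x | ∀ i j : Fin k, (((i : ℕ) = 0) ↔ ¬((j : ℕ) = 0)) → x i j = 0}
  add_mem' := by
    intro a b ha hb i j h
    simp [Matrix.add_apply, ha i j h, hb i j h]
  zero_mem' := by intro i j _; simp
  smul_mem' := by
    intro c a ha i j h
    simp [Matrix.smul_apply, ha i j h]

/-- the odd part of `Matrix (Fin k) (Fin k) F` under the elementary ℤ₂-grading
induced by `(0,1,…,1)`: matrices vanishing at the even positions -/
def matOddPart (k : ℕ) : Submodule F (Matrix (Fin k) (Fin k) F) where
  carrier := {x | ∀ i j : Fin k, (((i : ℕ) = 0) ↔ ((j : ℕ) = 0)) → x i j = 0}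
  add_mem' := by
    intro a b ha hb i j h
    simp [Matrix.add_apply, ha i j h, hb i j h]
  zero_mem' := by intro i j _; simp
  smul_mem' := by
    intro c a ha i j h
    simp [Matrix.smul_apply, ha i j h]

section Grassmann

variable (M : Type) [AddCommGroup M] [Module F M]

/-- the main involution of the Grassmann (exterior) algebra, negating the
generators -/
def grassInvol : ExteriorAlgebra F M →ₐ[F] ExteriorAlgebra F M :=
  ExteriorAlgebra.lift F ⟨-(ExteriorAlgebra.ι F (M := M)), fun m => by
    simp [ExteriorAlgebra.ι_sq_zero]⟩

/-- the even (degree-0) part of the canonical ℤ₂-grading of the Grassmann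
algebra: the span of `1` and the products of the generators of even length -/
def grEven : Submodule F (ExteriorAlgebra F M) :=
  LinearMap.ker ((grassInvol F M).toLinearMap - LinearMap.id)

/-- the odd (degree-1) part of the canonical ℤ₂-grading of the Grassmann
algebra: the span of the products of the generators of odd length -/
def grOdd : Submodule F (ExteriorAlgebra F M) :=
  LinearMap.ker ((grassInvol F M).toLinearMap + LinearMap.id)

end Grassmann

end

section Aux

open Finset

variable {F : Type} [Field F]

/-- abstract dimension count through a dual system -/
lemma finrank_quot_dual {V : Type} [AddCommGroup V] [Module F V] (P K : Submodule F V)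
    {ι : Type} [Fintype ι] [DecidableEq ι] (Φ : ι → V →ₗ[F] F)
    (hK : ∀ f ∈ P, f ∈ K ↔ ∀ i, Φ i f = 0)
    (hd : ∀ i, ∃ d ∈ P, ∀ i', Φ i' d = if i' = i then 1 else 0) :
    Module.finrank F (↥P ⧸ Submodule.comap P.subtype K) = Fintype.card ι := by
  let Ψ : P →ₗ[F] (ι → F) := (LinearMap.pi Φ).comp P.subtype
  have hker : Submodule.comap P.subtype K = LinearMap.ker Ψ := by
    ext ⟨f, hf⟩
    simp only [Submodule.mem_comap, Submodule.subtype_apply, LinearMap.mem_ker]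
    rw [hK f hf]
    constructor
    · intro h; ext i; exact h i
    · intro h i; exact congrFun h i
  have hsurj : Function.Surjective Ψ := by
    choose d hdP hd using hd
    intro g
    refine ⟨∑ i, g i • ⟨d i, hdP i⟩, ?_⟩
    ext i'
    simp only [map_sum, map_smul, Finset.sum_apply, Pi.smul_apply, smul_eq_mul]
    have : ∀ i, Ψ ⟨d i, hdP i⟩ i' = if i' = i then 1 else 0 := fun i => hd i i'
    simp [this]
  rw [hker, (LinearMap.quotKerEquivOfSurjective Ψ hsurj).finrank_eq, Module.finrank_pi]

/-- good lists: orderings of `0, …, n-1` -/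
def GoodL (n : ℕ) (l : List ℕ) : Prop := l.Nodup ∧ ∀ a, a ∈ l ↔ a < n

lemma GoodL.toFinset {n : ℕ} {l : List ℕ} (h : GoodL n l) : l.toFinset = range n := by
  ext a; simp [h.2 a]

variable (F) in
/-- the monomial attached to a list -/
def mon (l : List ℕ) : FA F := (l.map (yv F)).prod

lemma mon_mem {n : ℕ} {l : List ℕ} (h : GoodL n l) : mon F l ∈ PnGr F n := by
  have hlen : l.length = n := by
    rw [← List.toFinset_card_of_nodup h.1, h.toFinset, card_range]
  subst hlen
  let s : Fin l.length → Fin l.length := fun i => ⟨l[i], (h.2 _).1 (List.getElem_mem _)⟩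
  have hs : Function.Injective s := by
    intro a b hab
    have : l[a] = l[b] := congrArg Fin.val hab
    exact Fin.ext ((List.Nodup.getElem_inj_iff h.1).1 this)
  apply Submodule.subset_span
  refine ⟨Equiv.ofBijective s ⟨hs, Finite.surjective_of_injective hs⟩, fun _ => false, ?_⟩
  unfold mon
  congr 1
  apply List.ext_getElem
  · simp
  · intro i h1 h2
    simp [s]

lemma gen_cases {n : ℕ} (σ : Equiv.Perm (Fin n)) (w : Fin n → Bool) :
    (∃ l, GoodL n l ∧ (List.ofFn fun i : Fin n =>
        if w (σ i) then zv F (σ i).val else yv F (σ i).val).prod = mon F l) ∨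
    (∀ (B : Type) [Ring B] [Algebra F B] (ψ : FA F →ₐ[F] B), (∀ j, ψ (zv F j) = 0) →
      ψ (List.ofFn fun i : Fin n =>
        if w (σ i) then zv F (σ i).val else yv F (σ i).val).prod = 0) := by
  by_cases hw : ∃ i, w (σ i) = true
  · right
    intro B _ _ ψ hψ
    obtain ⟨i, hi⟩ := hw
    rw [map_list_prod]
    apply List.prod_eq_zero
    rw [List.mem_map]
    exact ⟨zv F (σ i).val, by rw [List.mem_ofFn]; exact ⟨i, by simp [hi]⟩, hψ _⟩
  · left
    push Not at hw
    refine ⟨List.ofFn fun i => (σ i).val, ⟨?_, ?_⟩, ?_⟩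
    · rw [List.nodup_ofFn]
      exact Fin.val_injective.comp σ.injective
    · intro a
      rw [List.mem_ofFn]
      constructor
      · rintro ⟨i, rfl⟩; exact (σ i).2
      · intro ha; exact ⟨σ.symm ⟨a, ha⟩, by simp⟩
    · unfold mon
      rw [List.map_ofFn]
      congr 2
      ext i
      simp [hw i]

/-- two linear maps built from evaluations killing `z` agree on `P_n` when they agree on monomials -/
lemma Pn_ext {n : ℕ} {V : Type} [AddCommGroup V] [Module F V] {B B' : Type} [Ring B] [Algebra F B]
    [Ring B'] [Algebra F B'] (ψ : FA F →ₐ[F] B) (ψ' : FA F →ₐ[F] B') (hψ : ∀ j, ψ (zv F j) = 0)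
    (hψ' : ∀ j, ψ' (zv F j) = 0) (α : B →ₗ[F] V) (β : B' →ₗ[F] V)
    (h : ∀ l, GoodL n l → α (ψ (mon F l)) = β (ψ' (mon F l)))
    {f : FA F} (hf : f ∈ PnGr F n) : α (ψ f) = β (ψ' f) := by
  induction hf using Submodule.span_induction with
  | mem m hm =>
    obtain ⟨σ, w, rfl⟩ := hm
    rcases gen_cases (F := F) σ w with ⟨l, hl, e⟩ | h0
    · rw [e]; exact h l hl
    · rw [h0 B ψ hψ, h0 B' ψ' hψ', map_zero, map_zero]
  | zero => simp
  | add a b _ _ ha hb => simp [ha, hb]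
  | smul c a _ ha => simp [ha]

variable (F) in
/-- `2 × 2` substitution detecting that `j` is first among `T` -/
def uM (T : Finset ℕ) (j : ℕ) (i : ℕ) : Matrix (Fin 2) (Fin 2) F :=
  if i = j then !![0, 1; 0, 0] else if i ∈ T then !![0, 0; 0, 1] else 1

variable (F) in
/-- evaluation -/
def evM {B : Type} [Ring B] [Algebra F B] (x : ℕ → B) : FA F →ₐ[F] B :=
  FreeAlgebra.lift F (Sum.elim x (fun _ => 0))

lemma evM_y {B : Type} [Ring B] [Algebra F B] (x : ℕ → B) (i : ℕ) : evM F x (yv F i) = x i := by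
  simp [evM, yv]

lemma evM_z {B : Type} [Ring B] [Algebra F B] (x : ℕ → B) (i : ℕ) : evM F x (zv F i) = 0 := by
  simp [evM, zv]

lemma map_mon {B : Type} [Ring B] [Algebra F B] (ψ : FA F →ₐ[F] B) (l : List ℕ) :
    ψ (mon F l) = (l.map fun i => ψ (yv F i)).prod := by
  unfold mon
  rw [map_list_prod, List.map_map]
  rfl

variable (F) in
/-- the functional `φ_{T,j}` -/
def LF (T : Finset ℕ) (j : ℕ) : FA F →ₗ[F] F :=
  (Matrix.entryLinearMap F F (0 : Fin 2) (1 : Fin 2)).comp (evM F (uM F T j)).toLinearMap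

lemma uM_list11 (T : Finset ℕ) (j : ℕ) (l : List ℕ) (h : j ∉ l) :
    ((l.map (uM F T j)).prod : Matrix (Fin 2) (Fin 2) F) 1 1 = 1 := by
  induction l with
  | nil => simp
  | cons i l ih =>
    simp only [List.mem_cons, not_or] at h
    rw [List.map_cons, List.prod_cons, Matrix.mul_apply, Fin.sum_univ_two, ih h.2]
    have : i ≠ j := fun e => h.1 e.symm
    unfold uM
    by_cases hi : i ∈ T <;> simp [this, hi]

lemma uM_list (T : Finset ℕ) (j : ℕ) (hj : j ∈ T) (l : List ℕ) (h : l.Nodup) :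
    ((l.map (uM F T j)).prod : Matrix (Fin 2) (Fin 2) F) 0 1 =
      if l.find? (· ∈ T) = some j then 1 else 0 := by
  induction l with
  | nil => simp
  | cons i l ih =>
    rw [List.nodup_cons] at h
    rw [List.map_cons, List.prod_cons, Matrix.mul_apply, Fin.sum_univ_two, ih h.2, List.find?_cons]
    by_cases hij : i = j
    · subst hij
      rw [uM_list11 _ _ _ h.1]
      simp [uM, hj]
    · by_cases hi : i ∈ T
      · simp [uM, hi, hij]
      · simp [uM, hi, hij]

lemma LF_mon (T : Finset ℕ) (j : ℕ) (hj : j ∈ T) (l : List ℕ) (h : l.Nodup) :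
    LF F T j (mon F l) = if l.find? (· ∈ T) = some j then 1 else 0 := by
  rw [← uM_list T j hj l h]
  change evM F (uM F T j) (mon F l) 0 1 = _
  rw [map_mon]
  simp only [evM_y]

/-! matrix computations -/

lemma E_mul_e (k q : ℕ) : EMat F k * eMat F k 0 q = 0 := by
  ext a b
  rw [Matrix.mul_apply]
  apply Finset.sum_eq_zero
  intro c _
  simp only [EMat, eMat, Matrix.of_apply]
  by_cases h : (a : ℕ) + 1 = c
  · have : (c : ℕ) ≠ 0 := by omega
    simp [this]
  · simp [h]

lemma e_mul_E (k q : ℕ) : eMat F k 0 q * EMat F k = eMat F k 0 (q + 1) := by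
  ext a b
  rw [Matrix.mul_apply]
  simp only [EMat, eMat, Matrix.of_apply]
  by_cases h : (a : ℕ) = 0 ∧ (b : ℕ) = q + 1
  · have hq : q < k := by have := b.2; omega
    rw [Finset.sum_eq_single ⟨q, hq⟩]
    · simp [h.1, h.2]
    · intro c _ hc
      have : (c : ℕ) ≠ q := fun e => hc (Fin.ext e)
      simp [this]
    · simp
  · rw [if_neg h]
    apply Finset.sum_eq_zero
    intro c _
    by_cases h1 : (a : ℕ) = 0 ∧ (c : ℕ) = q
    · have : ¬ ((c : ℕ) + 1 = b) := by omega
      simp [this]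
    · simp [h1]

lemma e_mul_Epow (k q p : ℕ) : eMat F k 0 q * EMat F k ^ p = eMat F k 0 (q + p) := by
  induction p with
  | zero => simp
  | succ p ih => rw [pow_succ, ← mul_assoc, ih, e_mul_E, add_assoc]

lemma Epow_mul_e (k q p : ℕ) (hp : p ≠ 0) : EMat F k ^ p * eMat F k 0 q = 0 := by
  obtain ⟨p, rfl⟩ := Nat.exists_eq_succ_of_ne_zero hp
  rw [pow_succ, mul_assoc, E_mul_e, mul_zero]

lemma e_zero (k q : ℕ) (h : k ≤ q) : eMat F k 0 q = 0 := by
  ext a b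
  have := b.2
  have : (b : ℕ) ≠ q := by omega
  simp [eMat, this]

lemma e_mul_e (k q q' : ℕ) (h : q ≠ 0) : eMat F k 0 q * eMat F k 0 q' = 0 := by
  ext a b
  rw [Matrix.mul_apply]
  apply Finset.sum_eq_zero
  intro c _
  simp only [eMat, Matrix.of_apply]
  by_cases h : (c : ℕ) = q
  · have : (c : ℕ) ≠ 0 := by omega
    simp [this]
  · simp [h]

lemma e_ne_zero (k q : ℕ) (h : q < k) : eMat F k 0 q ≠ 0 := by
  intro h0
  have := congrFun (congrFun h0 ⟨0, by omega⟩) ⟨q, h⟩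
  simp [eMat] at this

lemma list_E {k : ℕ} (x : ℕ → Matrix (Fin k) (Fin k) F) (p : ℕ → ℕ) (l : List ℕ)
    (hx : ∀ i ∈ l, x i = EMat F k ^ p i) : (l.map x).prod = EMat F k ^ (l.map p).sum := by
  induction l with
  | nil => simp
  | cons i l ih =>
    rw [List.map_cons, List.prod_cons, List.map_cons, List.sum_cons, pow_add,
      ih (fun a ha => hx a (List.mem_cons_of_mem _ ha)), hx i List.mem_cons_self]

lemma list_e {k : ℕ} (x : ℕ → Matrix (Fin k) (Fin k) F) (p : ℕ → ℕ) (T : Finset ℕ) (j q : ℕ)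
    (hj : j ∈ T) (hp : p j = 0) (hxj : x j = eMat F k 0 q) (l : List ℕ) (hl : l.Nodup) (hjl : j ∈ l)
    (hx : ∀ i ∈ l, i ≠ j → x i = EMat F k ^ p i ∧ (p i ≠ 0 ↔ i ∈ T)) :
    (l.map x).prod =
      (if l.find? (· ∈ T) = some j then (1 : F) else 0) • eMat F k 0 (q + (l.map p).sum) := by
  induction l with
  | nil => simp at hjl
  | cons i l ih =>
    rw [List.nodup_cons] at hl
    rw [List.map_cons, List.prod_cons, List.map_cons, List.sum_cons, List.find?_cons]
    by_cases hij : i = j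
    · subst hij
      rw [list_E x p l, hxj, e_mul_Epow]
      · simp [hj, hp]
      · intro a ha
        exact (hx a (List.mem_cons_of_mem _ ha) (fun e => hl.1 (e ▸ ha))).1
    · have hjl' : j ∈ l := by
        rcases List.mem_cons.1 hjl with h | h
        · exact absurd h.symm hij
        · exact h
      rw [ih hl.2 hjl' (fun a ha => hx a (List.mem_cons_of_mem _ ha))]
      obtain ⟨h1, h2⟩ := hx i List.mem_cons_self hij
      rw [h1]
      by_cases hi : i ∈ T
      · rw [mul_smul_comm, Epow_mul_e _ _ _ (h2.2 hi)]
        simp [hi, hij]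
      · have : p i = 0 := by by_contra h; exact hi (h2.1 h)
        simp [hi, this]

/-- column zero vanishes below the diagonal -/
def S0 {k : ℕ} (M : Matrix (Fin k) (Fin k) F) : Prop :=
  ∀ i j : Fin k, (i : ℕ) ≠ 0 → (j : ℕ) = 0 → M i j = 0

/-- only the first row is nonzero, with vanishing diagonal entry -/
def S1 {k : ℕ} (M : Matrix (Fin k) (Fin k) F) : Prop :=
  ∀ i j : Fin k, ((i : ℕ) ≠ 0 ∨ (j : ℕ) = 0) → M i j = 0

lemma S1.s0 {k : ℕ} {M : Matrix (Fin k) (Fin k) F} (h : S1 M) : S0 M :=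
  fun i j hi _ => h i j (Or.inl hi)

lemma S0.mul {k : ℕ} {M N : Matrix (Fin k) (Fin k) F} (h : S0 M) (h' : S0 N) : S0 (M * N) := by
  intro i j hi hj
  rw [Matrix.mul_apply]
  apply Finset.sum_eq_zero
  intro c _
  by_cases hc : (c : ℕ) = 0
  · rw [h i c hi hc, zero_mul]
  · rw [h' c j hc hj, mul_zero]

lemma S0.mul_s1 {k : ℕ} {M N : Matrix (Fin k) (Fin k) F} (h : S0 M) (h' : S1 N) : S1 (M * N) := by
  intro i j hij
  rw [Matrix.mul_apply]
  apply Finset.sum_eq_zero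
  intro c _
  by_cases hc : (c : ℕ) = 0
  · rcases hij with hi | hj
    · rw [h i c hi hc, zero_mul]
    · rw [h' c j (Or.inr hj), mul_zero]
  · rw [h' c j (Or.inl hc), mul_zero]

lemma S1.mul {k : ℕ} {M N : Matrix (Fin k) (Fin k) F} (h : S1 M) (h' : S0 N) : S1 (M * N) := by
  intro i j hij
  rw [Matrix.mul_apply]
  apply Finset.sum_eq_zero
  intro c _
  by_cases hc : (c : ℕ) = 0
  · rw [h i c (Or.inr hc), zero_mul]
  · rcases hij with hi | hj
    · rw [h i c (Or.inl hi), zero_mul]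
    · rw [h' c j hc hj, mul_zero]

lemma S1.mul_s1 {k : ℕ} {M N : Matrix (Fin k) (Fin k) F} (h : S1 M) (h' : S1 N) : M * N = 0 := by
  ext i j
  rw [Matrix.mul_apply]
  apply Finset.sum_eq_zero
  intro c _
  by_cases hc : (c : ℕ) = 0
  · rw [h i c (Or.inr hc), zero_mul]
  · rw [h' c j (Or.inl hc), mul_zero]

lemma S0_one {k : ℕ} : S0 (1 : Matrix (Fin k) (Fin k) F) := by
  intro i j hi hj
  rw [Matrix.one_apply_ne]
  intro h; subst h; exact hi hj

lemma S0_Epow (k p : ℕ) : S0 (EMat F k ^ p) := by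
  induction p with
  | zero => rw [pow_zero]; exact S0_one
  | succ p ih =>
    rw [pow_succ]
    apply ih.mul
    intro i j _ hj
    have : ¬ ((i : ℕ) + 1 = j) := by omega
    simp [EMat, this]

lemma S1_e (k q : ℕ) (hq : q ≠ 0) : S1 (eMat F k 0 q) := by
  intro i j h
  have : ¬ ((i : ℕ) = 0 ∧ (j : ℕ) = q) := by omega
  simp [eMat, this]

lemma list_S0 {k : ℕ} (x : ℕ → Matrix (Fin k) (Fin k) F) (l : List ℕ) (hx : ∀ i ∈ l, S0 (x i)) :
    S0 (l.map x).prod := by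
  induction l with
  | nil => simpa using S0_one
  | cons i l ih =>
    rw [List.map_cons, List.prod_cons]
    exact (hx i List.mem_cons_self).mul (ih fun a ha => hx a (List.mem_cons_of_mem _ ha))

lemma list_S1 {k : ℕ} (x : ℕ → Matrix (Fin k) (Fin k) F) (l : List ℕ) (hx : ∀ i ∈ l, S0 (x i))
    (j : ℕ) (hj : j ∈ l) (hxj : S1 (x j)) : S1 (l.map x).prod := by
  induction l with
  | nil => simp at hj
  | cons i l ih =>
    rw [List.map_cons, List.prod_cons]
    have h' : ∀ a ∈ l, S0 (x a) := fun a ha => hx a (List.mem_cons_of_mem _ ha)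
    rcases List.mem_cons.1 hj with h | h
    · subst h
      exact hxj.mul (list_S0 x l h')
    · exact (hx i List.mem_cons_self).mul_s1 (ih h' h)

lemma list_S1_two {k : ℕ} (x : ℕ → Matrix (Fin k) (Fin k) F) (l : List ℕ)
    (hx : ∀ i ∈ l, S0 (x i)) (j j' : ℕ) (hj : j ∈ l) (hxj : S1 (x j)) (hj' : j' ∈ l)
    (hxj' : S1 (x j')) (hne : j ≠ j') : (l.map x).prod = 0 := by
  induction l with
  | nil => simp at hj
  | cons i l ih =>
    rw [List.map_cons, List.prod_cons]
    have h' : ∀ a ∈ l, S0 (x a) := fun a ha => hx a (List.mem_cons_of_mem _ ha)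
    rcases List.mem_cons.1 hj with h | h
    · subst h
      rcases List.mem_cons.1 hj' with h2 | h2
      · exact absurd h2.symm hne
      · exact hxj.mul_s1 (list_S1 x l h' j' h2 hxj')
    · rcases List.mem_cons.1 hj' with h2 | h2
      · subst h2
        exact hxj'.mul_s1 (list_S1 x l h' j h hxj)
      · rw [ih h' h h2, mul_zero]

/-! evaluations of elements of `P_n` -/

lemma good_sum {n : ℕ} {l : List ℕ} (h : GoodL n l) (p : ℕ → ℕ) :
    (l.map p).sum = ∑ i ∈ range n, p i := by
  rw [← h.toFinset, List.sum_toFinset _ h.1]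

lemma eval_e {k n : ℕ} (ψ : FA F →ₐ[F] Matrix (Fin k) (Fin k) F) (hψ : ∀ j, ψ (zv F j) = 0)
    (p : ℕ → ℕ) (T : Finset ℕ) (j q : ℕ)
    (hj : j ∈ T) (hp : p j = 0) (hjn : j < n) (hxj : ψ (yv F j) = eMat F k 0 q)
    (hx : ∀ i < n, i ≠ j → ψ (yv F i) = EMat F k ^ p i ∧ (p i ≠ 0 ↔ i ∈ T))
    {f : FA F} (hf : f ∈ PnGr F n) :
    ψ f = LF F T j f • eMat F k 0 (q + ∑ i ∈ range n, p i) := by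
  refine Pn_ext ψ (evM F (uM F T j)) hψ (evM_z _) LinearMap.id
    ((Matrix.entryLinearMap F F (0 : Fin 2) (1 : Fin 2)).smulRight
      (eMat F k 0 (q + ∑ i ∈ range n, p i))) ?_ hf
  intro l hl
  change ψ (mon F l) = LF F T j (mon F l) • _
  rw [LF_mon T j hj l hl.1, map_mon,
    list_e (fun i => ψ (yv F i)) p T j q hj hp hxj l hl.1 ((hl.2 j).2 hjn), good_sum hl]
  intro i hi hij
  exact hx i ((hl.2 i).1 hi) hij

lemma find_zero {n : ℕ} (hn : 1 ≤ n) {l : List ℕ} (hl : GoodL n l) :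
    l.find? (· ∈ ({0} : Finset ℕ)) = some 0 := by
  cases h : l.find? (· ∈ ({0} : Finset ℕ)) with
  | none =>
    rw [List.find?_eq_none] at h
    exact absurd (by simp) (h 0 ((hl.2 0).2 hn))
  | some a =>
    have := List.find?_some h
    simp at this
    rw [this]

lemma eval_E {k n : ℕ} (hn : 1 ≤ n) (ψ : FA F →ₐ[F] Matrix (Fin k) (Fin k) F)
    (hψ : ∀ j, ψ (zv F j) = 0) (p : ℕ → ℕ) (hx : ∀ i < n, ψ (yv F i) = EMat F k ^ p i)
    {f : FA F} (hf : f ∈ PnGr F n) :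
    ψ f = LF F {0} 0 f • EMat F k ^ (∑ i ∈ range n, p i) := by
  refine Pn_ext ψ (evM F (uM F {0} 0)) hψ (evM_z _) LinearMap.id
    ((Matrix.entryLinearMap F F (0 : Fin 2) (1 : Fin 2)).smulRight
      (EMat F k ^ (∑ i ∈ range n, p i))) ?_ hf
  intro l hl
  change ψ (mon F l) = LF F {0} 0 (mon F l) • _
  rw [LF_mon {0} 0 (by simp) l hl.1, map_mon, find_zero hn hl,
    list_E (fun i => ψ (yv F i)) p l (fun i hi => hx i ((hl.2 i).1 hi)), good_sum hl]
  simp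

lemma eval_two {k n : ℕ} (ψ : FA F →ₐ[F] Matrix (Fin k) (Fin k) F)
    (hψ : ∀ j, ψ (zv F j) = 0) (hx : ∀ i < n, S0 (ψ (yv F i))) (j j' : ℕ) (hj : j < n) (hj' : j' < n)
    (hne : j ≠ j') (h1 : S1 (ψ (yv F j))) (h2 : S1 (ψ (yv F j')))
    {f : FA F} (hf : f ∈ PnGr F n) : ψ f = 0 := by
  refine Pn_ext (V := Matrix (Fin k) (Fin k) F) ψ ψ hψ hψ LinearMap.id 0 ?_ hf
  intro l hl
  rw [map_mon]
  exact list_S1_two (fun i => ψ (yv F i)) l (fun i hi => hx i ((hl.2 i).1 hi)) j j'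
    ((hl.2 j).2 hj) h1 ((hl.2 j').2 hj') h2 hne

lemma const_zero {n : ℕ} (hn : 1 ≤ n) {f : FA F} (hf : f ∈ PnGr F n) : constTerm F f = 0 := by
  refine Pn_ext (V := F) (constTerm F) (constTerm F) ?_ ?_ LinearMap.id 0 ?_ hf
  · intro j; simp [constTerm, zv]
  · intro j; simp [constTerm, zv]
  · intro l hl
    rw [map_mon]
    apply List.prod_eq_zero
    rw [List.mem_map]
    exact ⟨0, (hl.2 0).2 hn, by simp [constTerm, yv]⟩

/-- multilinearity -/
lemma exists_multilinear {n : ℕ} {B : Type} [Ring B] [Algebra F B] {f : FA F}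
    (hf : f ∈ PnGr F n) : ∃ μ : MultilinearMap F (fun _ : Fin n => B) B,
      ∀ x : ℕ → B, evM F x f = μ (fun i => x i) := by
  induction hf using Submodule.span_induction with
  | mem m hm =>
    obtain ⟨σ, w, rfl⟩ := hm
    by_cases hw : ∃ i, w (σ i) = true
    · refine ⟨0, fun x => ?_⟩
      obtain ⟨i, hi⟩ := hw
      rw [map_list_prod]
      apply List.prod_eq_zero
      rw [List.mem_map]
      exact ⟨zv F (σ i).val, by rw [List.mem_ofFn]; exact ⟨i, by simp [hi]⟩, evM_z _ _⟩
    · push Not at hw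
      refine ⟨(MultilinearMap.mkPiAlgebraFin F n B).domDomCongr σ, fun x => ?_⟩
      rw [map_list_prod, List.map_ofFn, MultilinearMap.domDomCongr_apply,
        MultilinearMap.mkPiAlgebraFin_apply]
      congr 2
      ext i
      simp [hw i, evM_y]
  | zero => exact ⟨0, fun x => by simp⟩
  | add a b _ _ ha hb =>
    obtain ⟨μ, hμ⟩ := ha
    obtain ⟨ν, hν⟩ := hb
    exact ⟨μ + ν, fun x => by simp [hμ, hν]⟩
  | smul c a _ ha =>
    obtain ⟨μ, hμ⟩ := ha
    exact ⟨c • μ, fun x => by simp [hμ]⟩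

lemma multilinear_span {n : ℕ} {B C : Type} [AddCommGroup B] [Module F B] [AddCommGroup C]
    [Module F C] (μ : MultilinearMap F (fun _ : Fin n => B) C) (G : Set B) (W : Submodule F C)
    (h : ∀ x : Fin n → B, (∀ i, x i ∈ G) → μ x ∈ W) (s : Finset (Fin n)) :
    ∀ x : Fin n → B, (∀ i ∈ s, x i ∈ Submodule.span F G) → (∀ i ∉ s, x i ∈ G) → μ x ∈ W := by
  induction s using Finset.induction_on with
  | empty => intro x _ h2; exact h x fun i => h2 i (by simp)
  | insert a s ha ih =>
    intro x h1 h2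
    have key : ∀ b ∈ Submodule.span F G, μ (Function.update x a b) ∈ W := by
      intro b hb
      induction hb using Submodule.span_induction with
      | mem b hb =>
        apply ih
        · intro i hi
          have : i ≠ a := fun e => ha (e ▸ hi)
          rw [Function.update_of_ne this]
          exact h1 i (mem_insert_of_mem hi)
        · intro i hi
          by_cases hia : i = a
          · subst hia; simpa using hb
          · rw [Function.update_of_ne hia]
            exact h2 i (by simp [hia, hi])
      | zero => simp
      | add b c _ _ hb hc => rw [MultilinearMap.map_update_add]; exact W.add_mem hb hc
      | smul c b _ hb => rw [MultilinearMap.map_update_smul]; exact W.smul_mem c hb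
    have := key (x a) (h1 a (mem_insert_self _ _))
    rwa [Function.update_eq_self] at this


lemma eval_std {k n : ℕ} {T : Finset ℕ} (hT : T ⊆ range n) {j : ℕ} (hj : j ∈ T)
    {f : FA F} (hf : f ∈ PnGr F n) :
    evM F (fun i => if i = j then eMat F k 0 1 else if i ∈ T then EMat F k else 1) f =
      LF F T j f • eMat F k 0 T.card := by
  have h := eval_e (k := k) (n := n)
    (evM F (fun i => if i = j then eMat F k 0 1 else if i ∈ T then EMat F k else 1))
    (evM_z _) (fun i => if i ∈ T.erase j then 1 else 0) T j 1 hj (by simp)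
    (mem_range.1 (hT hj)) (by rw [evM_y]; simp) ?_ hf
  · rw [h]
    congr 2
    rw [← Finset.sum_filter, Finset.filter_mem_eq_inter,
      Finset.inter_eq_right.2 ((erase_subset _ _).trans hT)]
    simp only [sum_const, smul_eq_mul, mul_one]
    have := card_erase_add_one hj
    omega
  · intro i _ hij
    rw [evM_y]
    by_cases hi : i ∈ T <;> simp [hij, hi]

lemma one_mem_N (k : ℕ) : (1 : Matrix (Fin k) (Fin k) F) ∈ NkSub F k :=
  Submodule.subset_span (Or.inl (Or.inl rfl))

lemma E_mem_N {k : ℕ} (hk : 3 ≤ k) : EMat F k ∈ NkSub F k :=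
  Submodule.subset_span (Or.inl (Or.inr ⟨1, le_refl _, by omega, by simp⟩))

lemma e_mem_N {k q : ℕ} (hq : q ≠ 0) (hk : q ≤ k - 1) : eMat F k 0 q ∈ NkSub F k :=
  Submodule.subset_span (Or.inr ⟨q, by omega, hk, rfl⟩)

lemma std_subst {k : ℕ} (hk : 3 ≤ k) (T : Finset ℕ) (j : ℕ) :
    IsGSubst F (Matrix (Fin k) (Fin k) F) (NkSub F k) ⊥
      (evM F (fun i => if i = j then eMat F k 0 1 else if i ∈ T then EMat F k else 1)) := by
  constructor
  · intro i
    rw [evM_y]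
    split_ifs
    · exact e_mem_N one_ne_zero (by omega)
    · exact E_mem_N hk
    · exact one_mem_N k
  · intro i
    rw [evM_z]
    exact Submodule.zero_mem _

lemma e_central {k q : ℕ} (hk : 3 ≤ k) (hq : k - 1 ≤ q) :
    eMat F k 0 q ∈ centerIn F (Matrix (Fin k) (Fin k) F) (NkSub F k ⊔ ⊥) := by
  rw [sup_bot_eq]
  rcases Nat.lt_or_ge q k with h | h
  · refine ⟨e_mem_N (by omega) (by omega), ?_⟩
    intro y hy
    induction hy using Submodule.span_induction with
    | mem y hy =>
      rcases hy with (hy | ⟨m, h1, h2, rfl⟩) | ⟨m, h1, h2, rfl⟩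
      · rw [Set.mem_singleton_iff] at hy
        rw [hy, mul_one, one_mul]
      · rw [e_mul_Epow, Epow_mul_e _ _ _ (by omega), e_zero _ _ (by omega)]
      · rw [e_mul_e _ _ _ (by omega), e_mul_e _ _ _ (by omega)]
    | zero => simp
    | add a b _ _ ha hb => rw [mul_add, add_mul, ha, hb]
    | smul c a _ ha => rw [mul_smul_comm, smul_mul_assoc, ha]
  · rw [e_zero _ _ h]
    exact Submodule.zero_mem _

/-- main sufficiency lemma -/
lemma eval_mem {k n : ℕ} (hn : 1 ≤ n) (b : ℕ) (hb : 1 ≤ b)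
    (W : Submodule F (Matrix (Fin k) (Fin k) F)) (hW : ∀ q, b + 1 ≤ q → eMat F k 0 q ∈ W)
    {f : FA F} (hf : f ∈ PnGr F n)
    (h : ∀ T ⊆ range n, ∀ j ∈ T, T.card ≤ b → LF F T j f = 0)
    (φ : FA F →ₐ[F] Matrix (Fin k) (Fin k) F)
    (hφ : IsGSubst F (Matrix (Fin k) (Fin k) F) (NkSub F k) ⊥ φ) : φ f ∈ W := by
  have hφe : φ = evM F (fun i => φ (yv F i)) := by
    apply FreeAlgebra.hom_ext
    ext i
    rcases i with i | i
    · have h2 := evM_y (F := F) (fun i => φ (yv F i)) i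
      exact congrFun (congrFun h2.symm _) _
    · have h1 : φ (zv F i) = 0 := by simpa using hφ.2 i
      have h2 := evM_z (F := F) (fun i => φ (yv F i)) i
      exact congrFun (congrFun (h1.trans h2.symm) _) _
  obtain ⟨μ, hμ⟩ := exists_multilinear (B := Matrix (Fin k) (Fin k) F) hf
  rw [hφe, hμ]
  refine multilinear_span μ _ W ?_ Finset.univ _ (fun i _ => hφ.1 i) (by simp)
  intro x hx
  -- extend `x` to all naturals
  let X : ℕ → Matrix (Fin k) (Fin k) F := fun i => if h : i < n then x ⟨i, h⟩ else 1
  have hX : x = fun i : Fin n => X i := by ext1 i; simp [X]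
  rw [hX, ← hμ X]
  have hXc : ∀ i < n, (∃ p, X i = EMat F k ^ p) ∨ (∃ q, q ≠ 0 ∧ X i = eMat F k 0 q) := by
    intro i hi
    have e : X i = x ⟨i, hi⟩ := by simp [X, hi]
    rw [e]
    rcases hx ⟨i, hi⟩ with (hy | ⟨m, h1, h2, h3⟩) | ⟨m, h1, h2, h3⟩
    · left; exact ⟨0, by rw [pow_zero]; exact hy⟩
    · left; exact ⟨m, h3⟩
    · right; exact ⟨m, by omega, h3⟩
  by_cases hE : ∀ i < n, ∃ p, X i = EMat F k ^ p
  · choose! p hp using hE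
    rw [eval_E hn (evM F X) (evM_z X) p (fun i hi => by rw [evM_y, hp i hi]) hf,
      h {0} (by simp; omega) 0 (by simp) (by simpa using hb), zero_smul]
    exact W.zero_mem
  · push Not at hE
    obtain ⟨j, hjn, hj⟩ := hE
    obtain ⟨q, hq, hjq⟩ := (hXc j hjn).resolve_left (fun ⟨p, hp⟩ => hj p hp)
    by_cases h2 : ∃ j' < n, j' ≠ j ∧ ∃ q, q ≠ 0 ∧ X j' = eMat F k 0 q
    · obtain ⟨j', hj'n, hne, q', hq', hjq'⟩ := h2
      rw [eval_two (evM F X) (evM_z X) ?_ j j' hjn hj'n hne.symm ?_ ?_ hf]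
      · exact W.zero_mem
      · intro i hi
        rw [evM_y]
        rcases hXc i hi with ⟨p, hp⟩ | ⟨q, hq, hp⟩
        · rw [hp]; exact S0_Epow k p
        · rw [hp]; exact (S1_e k q hq).s0
      · rw [evM_y, hjq]; exact S1_e k q hq
      · rw [evM_y, hjq']; exact S1_e k q' hq'
    · push Not at h2
      have hp : ∀ i, i < n → i ≠ j → ∃ p, X i = EMat F k ^ p := by
        intro i hi hij
        rcases hXc i hi with hp | ⟨q, hq, hp⟩
        · exact hp
        · exact absurd hp (h2 i hi hij q hq)
      choose! p' hp' using hp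
      let p : ℕ → ℕ := fun i => if i = j then 0 else p' i
      let T : Finset ℕ := insert j ((range n).filter fun i => p i ≠ 0)
      have hT : T ⊆ range n := by
        intro i hi
        rcases mem_insert.1 hi with rfl | hi
        · exact mem_range.2 hjn
        · exact (mem_filter.1 hi).1
      have hjT : j ∈ T := mem_insert_self _ _
      rw [eval_e (evM F X) (evM_z X) p T j q hjT (by simp [p]) hjn (by rw [evM_y, hjq]) ?_ hf]
      · by_cases hc : T.card ≤ b
        · rw [h T hT j hjT hc, zero_smul]; exact W.zero_mem
        · apply W.smul_mem
          apply hW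
          have h1 : T.card ≤ ((range n).filter fun i => p i ≠ 0).card + 1 := card_insert_le _ _
          have h3 : ((range n).filter fun i => p i ≠ 0).card ≤ ∑ i ∈ range n, p i := by
            rw [card_filter]
            apply Finset.sum_le_sum
            intro i _
            split_ifs <;> omega
          omega
      · intro i hi hij
        rw [evM_y, hp' i hi hij]
        refine ⟨by simp [p, hij], ?_⟩
        simp [T, hij, hi]

lemma mem_C {k n : ℕ} (hk : 3 ≤ k) (hn : 1 ≤ n) {f : FA F} (hf : f ∈ PnGr F n) :
    f ∈ CGr F (Matrix (Fin k) (Fin k) F) (NkSub F k) ⊥ ↔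
      ∀ T ⊆ range n, ∀ j ∈ T, T.card ≤ k - 2 → LF F T j f = 0 := by
  constructor
  · rintro ⟨-, h⟩ T hT j hj hc
    have h1 := (h _ (std_subst hk T j)).2 (EMat F k) (by rw [sup_bot_eq]; exact E_mem_N hk)
    rw [eval_std hT hj hf, smul_mul_assoc, mul_smul_comm, e_mul_E, E_mul_e, smul_zero,
      smul_eq_zero] at h1
    exact h1.resolve_right (e_ne_zero _ _ (by omega))
  · intro h
    refine ⟨const_zero hn hf, ?_⟩
    exact eval_mem hn (k - 2) (by omega) _ (fun q hq => e_central hk (by omega)) hf h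

lemma mem_I {k n : ℕ} (hk : 3 ≤ k) (hn : 1 ≤ n) {f : FA F} (hf : f ∈ PnGr F n) :
    f ∈ IdGr F (Matrix (Fin k) (Fin k) F) (NkSub F k) ⊥ ↔
      ∀ T ⊆ range n, ∀ j ∈ T, T.card ≤ k - 1 → LF F T j f = 0 := by
  constructor
  · intro h T hT j hj hc
    have h1 := h _ (std_subst hk T j)
    rw [eval_std hT hj hf, smul_eq_zero] at h1
    exact h1.resolve_right (e_ne_zero _ _ (by omega))
  · intro h φ hφ
    exact (Submodule.mem_bot F).1 (eval_mem hn (k - 1) (by omega) ⊥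
      (fun q hq => (Submodule.mem_bot F).2 (e_zero _ _ (by omega))) hf h φ hφ)

/-! relations and dual elements -/

lemma find_exists {n : ℕ} {l : List ℕ} (hl : GoodL n l) {T : Finset ℕ} (hT : T ⊆ range n)
    (hne : T.Nonempty) : ∃ a ∈ T, l.find? (· ∈ T) = some a := by
  cases h : l.find? (· ∈ T) with
  | none =>
    rw [List.find?_eq_none] at h
    obtain ⟨a, ha⟩ := hne
    exact absurd (by simpa using ha) (h a ((hl.2 a).2 (mem_range.1 (hT ha))))
  | some a => exact ⟨a, by simpa using List.find?_some h, rfl⟩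

lemma LF_sum {n : ℕ} (hn : 1 ≤ n) {T : Finset ℕ} (hT : T ⊆ range n) (hne : T.Nonempty)
    {f : FA F} (hf : f ∈ PnGr F n) : ∑ j ∈ T, LF F T j f = LF F {0} 0 f := by
  induction hf using Submodule.span_induction with
  | mem m hm =>
    obtain ⟨σ, w, rfl⟩ := hm
    rcases gen_cases (F := F) σ w with ⟨l, hl, e⟩ | h0
    · rw [e, LF_mon {0} 0 (by simp) l hl.1, find_zero hn hl, if_pos rfl]
      obtain ⟨a, ha, hfa⟩ := find_exists hl hT hne
      rw [Finset.sum_congr rfl fun j hj => LF_mon T j hj l hl.1, hfa]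
      simp [ha]
    · have h1 : ∀ T j, LF F T j (List.ofFn fun i : Fin n =>
        if w (σ i) then zv F (σ i).val else yv F (σ i).val).prod = 0 := by
        intro T j
        have := h0 _ (evM F (uM F T j)) (evM_z _)
        exact congrFun (congrFun this 0) 1
      simp [h1]
  | zero => simp
  | add a b _ _ ha hb => simp only [map_add, sum_add_distrib, ha, hb]
  | smul c a _ ha => simp only [map_smul, ← Finset.smul_sum, ha]

/-- the excluded element of `T` -/
def exc (n : ℕ) (T : Finset ℕ) : Option ℕ := (List.range n).find? (· ∈ T)

lemma good_range (n : ℕ) : GoodL n (List.range n) := ⟨List.nodup_range, by simp⟩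

lemma LF_all {n : ℕ} (hn : 1 ≤ n) {f : FA F} (hf : f ∈ PnGr F n) (h0 : LF F {0} 0 f = 0)
    {T : Finset ℕ} (hT : T ⊆ range n) (h : ∀ j ∈ T, exc n T ≠ some j → LF F T j f = 0) :
    ∀ j ∈ T, LF F T j f = 0 := by
  intro j hj
  by_cases he : exc n T = some j
  · have := LF_sum hn hT ⟨j, hj⟩ hf
    rw [h0, Finset.sum_eq_single j] at this
    · exact this
    · intro i hi hij
      apply h i hi
      rw [he]
      intro e
      exact hij (Option.some.inj e).symm
    · exact fun h => absurd hj h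
  · exact h j hj he

lemma card_nonexc {n : ℕ} {T : Finset ℕ} (hT : T ⊆ range n) :
    (T.filter fun j => exc n T ≠ some j).card = T.card - 1 := by
  rcases T.eq_empty_or_nonempty with rfl | hne
  · simp
  · obtain ⟨a, ha, h⟩ := find_exists (good_range n) hT hne
    rw [← card_erase_of_mem ha]
    congr 1
    ext i
    simp only [mem_filter, mem_erase, exc, h]
    constructor
    · rintro ⟨h1, h2⟩; exact ⟨fun e => h2 (by rw [e]), h1⟩
    · rintro ⟨h1, h2⟩; exact ⟨h2, fun e => h1 (Option.some.inj e).symm⟩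

lemma exists_d {n : ℕ} (hn : 1 ≤ n) {T : Finset ℕ} (hT : T ⊆ range n) {j : ℕ} (hj : j ∈ T) :
    ∃ d ∈ PnGr F n, LF F {0} 0 d = 0 ∧ ∀ T' ⊆ range n, ∀ j' ∈ T', exc n T' ≠ some j' →
      LF F T' j' d = if T' ⊆ T ∧ j' = j then 1 else 0 := by
  let R := (List.range n).filter (· ∉ T)
  let l1 := R ++ j :: (List.range n).filter (fun a => a ∈ T ∧ a ≠ j)
  let l2 := R ++ (List.range n).filter (· ∈ T)
  have hjn : j < n := mem_range.1 (hT hj)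
  have g1 : GoodL n l1 := by
    constructor
    · rw [List.nodup_append']
      refine ⟨List.nodup_range.filter _, ?_, ?_⟩
      · rw [List.nodup_cons]
        exact ⟨by simp, List.nodup_range.filter _⟩
      · intro a ha hb
        simp only [R, List.mem_filter, List.mem_cons, decide_eq_true_eq] at ha hb
        rcases hb with rfl | hb
        · exact ha.2 hj
        · exact ha.2 hb.2.1
    · intro a
      simp only [l1, R, List.mem_append, List.mem_filter, List.mem_cons, decide_eq_true_eq,
        List.mem_range]
      constructor
      · rintro (h | rfl | h)
        · exact h.1
        · exact hjn
        · exact h.1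
      · intro h
        by_cases h1 : a ∈ T <;> by_cases h2 : a = j <;> simp [h, h1, h2]
  have g2 : GoodL n l2 := by
    constructor
    · rw [List.nodup_append']
      refine ⟨List.nodup_range.filter _, List.nodup_range.filter _, ?_⟩
      intro a ha hb
      simp only [R, List.mem_filter, decide_eq_true_eq] at ha hb
      exact ha.2 hb.2
    · intro a
      simp only [l2, R, List.mem_append, List.mem_filter, decide_eq_true_eq,
        List.mem_range]
      by_cases h1 : a ∈ T <;> simp [h1]
  refine ⟨mon F l1 - mon F l2, Submodule.sub_mem _ (mon_mem g1) (mon_mem g2), ?_, ?_⟩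
  · rw [map_sub, LF_mon _ _ (by simp) _ g1.1, LF_mon _ _ (by simp) _ g2.1, find_zero hn g1,
      find_zero hn g2, sub_self]
  · intro T' hT' j' hj' hex
    rw [map_sub, LF_mon _ _ hj' _ g1.1, LF_mon _ _ hj' _ g2.1]
    simp only [l1, l2, List.find?_append]
    cases h : R.find? (· ∈ T') with
    | some a =>
      have h1 : a ∈ T' := by simpa using List.find?_some h
      have h2 : a ∉ T := by
        have := List.mem_of_find?_eq_some h
        simp only [R, List.mem_filter, decide_eq_true_eq] at this
        exact this.2
      have h3 : ¬ (T' ⊆ T) := fun hs => h2 (hs h1)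
      simp [h3]
    | none =>
      have hs : T' ⊆ T := by
        intro a ha
        by_contra hna
        rw [List.find?_eq_none] at h
        apply h a
        · simp only [R, List.mem_filter, decide_eq_true_eq, List.mem_range]
          exact ⟨mem_range.1 (hT' ha), hna⟩
        · simpa using ha
      have e2 : ((List.range n).filter (· ∈ T)).find? (· ∈ T') = exc n T' := by
        rw [List.find?_filter, exc]
        congr 1
        ext a
        by_cases ha : a ∈ T'
        · simp [ha, hs ha]
        · simp [ha]
      rw [e2, Option.none_or, Option.none_or, if_neg hex, sub_zero, List.find?_cons]
      by_cases hjT : j ∈ T'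
      · simp [hjT, hs, eq_comm]
      · have e1 : ((List.range n).filter (fun a => a ∈ T ∧ a ≠ j)).find? (· ∈ T') = exc n T' := by
          rw [List.find?_filter, exc]
          congr 1
          ext a
          by_cases ha : a ∈ T'
          · have : a ≠ j := fun e => hjT (e ▸ ha)
            simp [ha, hs ha, this]
          · simp [ha]
        have : j' ≠ j := fun e => hjT (e ▸ hj')
        simp only [hjT, decide_false, e1, if_neg hex, this, and_false, if_false]

lemma exists_dual {n : ℕ} (hn : 1 ≤ n) (j : ℕ) (T : Finset ℕ) : T ⊆ range n → j ∈ T →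
    exc n T ≠ some j →
    ∃ d ∈ PnGr F n, LF F {0} 0 d = 0 ∧ ∀ T' ⊆ range n, ∀ j' ∈ T', exc n T' ≠ some j' →
      LF F T' j' d = if T' = T ∧ j' = j then 1 else 0 := by
  induction T using Finset.strongInduction with
  | H T ih =>
    intro hT hj hex
    obtain ⟨d, hd, hd0, hd1⟩ := exists_d (F := F) hn hT hj
    have ih' : ∀ S : Finset ℕ, S ⊂ T ∧ j ∈ S ∧ exc n S ≠ some j → ∃ d ∈ PnGr F n,
        LF F {0} 0 d = 0 ∧ ∀ T' ⊆ range n, ∀ j' ∈ T', exc n T' ≠ some j' →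
      LF F T' j' d = if T' = S ∧ j' = j then 1 else 0 :=
      fun S hS => ih S hS.1 (hS.1.subset.trans hT) hS.2.1 hS.2.2
    choose! D hD hD0 hD1 using ih'
    let Q := T.ssubsets.filter (fun S => j ∈ S ∧ exc n S ≠ some j)
    have hQ : ∀ S ∈ Q, S ⊂ T ∧ j ∈ S ∧ exc n S ≠ some j := by
      intro S hS
      simpa [Q] using hS
    refine ⟨d - ∑ S ∈ Q, D S, Submodule.sub_mem _ hd (Submodule.sum_mem _ fun S hS => hD S (hQ S hS)),
      ?_, ?_⟩
    · rw [map_sub, hd0, map_sum, Finset.sum_eq_zero fun S hS => hD0 S (hQ S hS), sub_zero]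
    · intro T' hT' j' hj' hex'
      rw [map_sub, hd1 T' hT' j' hj' hex', map_sum,
        Finset.sum_congr rfl fun S hS => hD1 S (hQ S hS) T' hT' j' hj' hex']
      by_cases hjj : j' = j
      · subst hjj
        simp only [and_true, Finset.sum_ite_eq]
        by_cases h1 : T' ⊆ T
        · by_cases h2 : T' = T
          · subst h2
            have : T' ∉ Q := fun h => (hQ T' h).1.ne rfl
            simp [this]
          · have : T' ∈ Q := by
              simp only [Q, mem_filter, mem_ssubsets]
              exact ⟨lt_of_le_of_ne h1 h2, hj', hex'⟩
            simp [this, h1, h2]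
        · have h2 : T' ≠ T := fun e => h1 e.subset
          have : T' ∉ Q := fun h => h1 (hQ T' h).1.subset
          simp [this, h1, h2]
      · simp [hjj]

/-- index set -/
def Idx (n : ℕ) (A : Finset (Finset ℕ)) : Finset (Σ _ : Finset ℕ, ℕ) :=
  A.sigma fun T => T.filter fun j => exc n T ≠ some j

lemma mem_Idx {n : ℕ} {A : Finset (Finset ℕ)} {x : Σ _ : Finset ℕ, ℕ} :
    x ∈ Idx n A ↔ x.1 ∈ A ∧ x.2 ∈ x.1 ∧ exc n x.1 ≠ some x.2 := by
  simp [Idx]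

lemma card_Idx {n : ℕ} {A : Finset (Finset ℕ)} (hA : ∀ T ∈ A, T ⊆ range n) :
    (Idx n A).card = ∑ T ∈ A, (T.card - 1) := by
  rw [Idx, card_sigma]
  exact Finset.sum_congr rfl fun T hT => card_nonexc (hA T hT)

lemma exc_subset_one {n : ℕ} {T : Finset ℕ} (hT : T ⊆ range n) (hc : T.card ≤ 1) {j : ℕ}
    (hj : j ∈ T) : exc n T = some j := by
  obtain ⟨a, ha, h⟩ := find_exists (good_range n) hT ⟨j, hj⟩
  rw [Finset.card_le_one] at hc
  rw [exc, h, hc a ha j hj]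

lemma part_one {k n : ℕ} (hk : 3 ≤ k) (hn : 1 ≤ n) :
    scodim F (PnGr F n) (CGr F (Matrix (Fin k) (Fin k) F) (NkSub F k) ⊥) =
        1 + ∑ i ∈ Finset.Icc 2 (k - 2), Nat.choose n i * (i - 1) := by
  let A := (range n).powerset.filter fun T => 2 ≤ T.card ∧ T.card ≤ k - 2
  have hA : ∀ T ∈ A, T ⊆ range n := fun T hT => mem_powerset.1 (mem_filter.1 hT).1
  let Φ : Option {x // x ∈ Idx n A} → FA F →ₗ[F] F := fun o =>
    o.elim (LF F {0} 0) (fun x => LF F x.1.1 x.1.2)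
  unfold scodim
  rw [finrank_quot_dual (PnGr F n) _ Φ]
  · rw [Fintype.card_option, Fintype.card_coe, card_Idx hA, add_comm]
    congr 1
    rw [← Finset.sum_fiberwise_of_maps_to (s := A) (t := Icc 2 (k - 2)) (g := Finset.card)]
    · apply Finset.sum_congr rfl
      intro i hi
      rw [mem_Icc] at hi
      have : A.filter (fun T => T.card = i) = powersetCard i (range n) := by
        ext T
        simp only [A, mem_filter, mem_powerset, mem_powersetCard]
        constructor
        · rintro ⟨⟨h1, _⟩, h2⟩; exact ⟨h1, h2⟩
        · rintro ⟨h1, h2⟩; exact ⟨⟨h1, by omega⟩, h2⟩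
      rw [this, Finset.sum_congr rfl (g := fun _ => i - 1)]
      · simp
      · intro T hT
        rw [(mem_powersetCard.1 hT).2]
    · intro T hT
      exact mem_Icc.2 (mem_filter.1 hT).2
  · intro f hf
    rw [mem_C hk hn hf]
    constructor
    · rintro h (_ | ⟨x, hx⟩)
      · exact h {0} (by simp; omega) 0 (by simp) (by simp; omega)
      · have hx' := mem_Idx.1 hx
        exact h x.1 (hA _ hx'.1) x.2 hx'.2.1 (mem_filter.1 hx'.1).2.2
    · intro h T hT j hj hc
      apply LF_all hn hf (h none) hT _ j hj
      intro i hi hex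
      have h2 : 2 ≤ T.card := by
        by_contra hlt
        exact hex (exc_subset_one hT (by omega) hi)
      exact h (some ⟨⟨T, i⟩, mem_Idx.2 ⟨mem_filter.2 ⟨mem_powerset.2 hT, h2, hc⟩, hi, hex⟩⟩)
  · rintro (_ | ⟨x, hx⟩)
    · refine ⟨mon F (List.range n), mon_mem (good_range n), ?_⟩
      rintro (_ | ⟨y, hy⟩)
      · change LF F {0} 0 _ = _
        rw [LF_mon _ _ (by simp) _ (good_range n).1, find_zero hn (good_range n)]
        simp
      · have hy' := mem_Idx.1 hy
        change LF F y.1 y.2 _ = _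
        rw [LF_mon _ _ hy'.2.1 _ (good_range n).1]
        rw [if_neg (show ¬ (List.range n).find? (· ∈ y.1) = some y.2 from hy'.2.2)]
        simp
    · have hx' := mem_Idx.1 hx
      obtain ⟨d, hd, hd0, hd1⟩ := exists_dual (F := F) hn x.2 x.1 (hA _ hx'.1) hx'.2.1 hx'.2.2
      refine ⟨d, hd, ?_⟩
      rintro (_ | ⟨y, hy⟩)
      · change LF F {0} 0 _ = _
        rw [hd0]
        simp
      · have hy' := mem_Idx.1 hy
        change LF F y.1 y.2 _ = _
        rw [hd1 y.1 (hA _ hy'.1) y.2 hy'.2.1 hy'.2.2]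
        simp [Sigma.ext_iff]

lemma part_two {k n : ℕ} (hk : 3 ≤ k) (hn : 1 ≤ n) :
    deltaDim F (PnGr F n) (CGr F (Matrix (Fin k) (Fin k) F) (NkSub F k) ⊥)
        (IdGr F (Matrix (Fin k) (Fin k) F) (NkSub F k) ⊥) =
      (k - 2) * Nat.choose n (k - 1) := by
  let A := powersetCard (k - 1) (range n)
  have hA : ∀ T ∈ A, T ⊆ range n := fun T hT => (mem_powersetCard.1 hT).1
  let Φ : {x // x ∈ Idx n A} → FA F →ₗ[F] F := fun x => LF F x.1.1 x.1.2
  unfold deltaDim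
  rw [finrank_quot_dual (PnGr F n ⊓ CGr F (Matrix (Fin k) (Fin k) F) (NkSub F k) ⊥) _ Φ]
  · rw [Fintype.card_coe, card_Idx hA, Finset.sum_congr rfl (g := fun _ => k - 2)]
    · simp [A, mul_comm]
    · intro T hT
      rw [(mem_powersetCard.1 hT).2]
      omega
  · rintro f ⟨hf, hfC⟩
    replace hf : f ∈ PnGr F n := hf
    rw [SetLike.mem_coe, mem_C hk hn hf] at hfC
    rw [Submodule.mem_inf, and_iff_right hf, mem_I hk hn hf]
    constructor
    · rintro h ⟨x, hx⟩
      have hx' := mem_Idx.1 hx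
      exact h x.1 (hA _ hx'.1) x.2 hx'.2.1 (mem_powersetCard.1 hx'.1).2.le
    · intro h T hT j hj hc
      apply LF_all hn hf (hfC {0} (by simp; omega) 0 (by simp) (by simp; omega)) hT _ j hj
      intro i hi hex
      by_cases h2 : T.card ≤ k - 2
      · exact hfC T hT i hi h2
      · have h3 : T.card = k - 1 := by omega
        exact h ⟨⟨T, i⟩, mem_Idx.2 ⟨mem_powersetCard.2 ⟨hT, h3⟩, hi, hex⟩⟩
  · rintro ⟨x, hx⟩
    have hx' := mem_Idx.1 hx
    obtain ⟨d, hd, hd0, hd1⟩ := exists_dual (F := F) hn x.2 x.1 (hA _ hx'.1) hx'.2.1 hx'.2.2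
    refine ⟨d, ⟨hd, ?_⟩, ?_⟩
    · rw [SetLike.mem_coe, mem_C hk hn hd]
      intro T hT j hj hc
      apply LF_all hn hd hd0 hT _ j hj
      intro i hi hex
      rw [hd1 T hT i hi hex, if_neg]
      rintro ⟨rfl, -⟩
      have := (mem_powersetCard.1 hx'.1).2
      omega
    · rintro ⟨y, hy⟩
      have hy' := mem_Idx.1 hy
      change LF F y.1 y.2 _ = _
      rw [hd1 y.1 (hA _ hy'.1) y.2 hy'.2.1 hy'.2.2]
      simp [Sigma.ext_iff]

end Aux

/-- for `k ≥ 3`, `n ≥ 1`: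
`c_n^{gr,z}(N_k) = 1 + Σ_{i=2}^{k-2} C(n,i)(i-1)` and
`δ_n^{gr}(N_k) = (k-2)·C(n,k-1)` (trivial grading). -/
theorem stmt7 (F : Type) [Field F] [CharZero F] (k n : ℕ) (hk : 3 ≤ k) (hn : 1 ≤ n) :
    scodim F (PnGr F n) (CGr F (Matrix (Fin k) (Fin k) F) (NkSub F k) ⊥) =
        1 + ∑ i ∈ Finset.Icc 2 (k - 2), Nat.choose n i * (i - 1) ∧
    deltaDim F (PnGr F n) (CGr F (Matrix (Fin k) (Fin k) F) (NkSub F k) ⊥)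
        (IdGr F (Matrix (Fin k) (Fin k) F) (NkSub F k) ⊥) =
      (k - 2) * Nat.choose n (k - 1) := by
  exact ⟨part_one hk hn, part_two hk hn⟩
end

section
/- For every k ≥ 2, the superalgebras A_k and B_k with the trivial grading satisfy C^gr(A_k) = Id^gr(A_k) and C^gr(B_k) = Id^gr(B_k); consequently δ_n^{gr}(A_k) = δ_n^{gr}(B_k) = 0 for all n ≥ 1, and for all n ≥ k one has c_n^{gr,z}(A_k) = c_n^{gr,z}(B_k) = 1 + Σ_{i=0}^{k−2} C(n,i)·(n−i−1). -/
namespace Stmt8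

/-- sum of `h (suffix set) (head)` along all the nonempty suffixes of a list -/
def pathSum {n : ℕ} {M : Type} [AddCommGroup M] (h : Finset (Fin n) → Fin n → M) :
    List (Fin n) → M
  | [] => 0
  | x :: xs => h xs.toFinset x + pathSum h xs

/-- the incidence of the edge `(T,j)` with the path of the list `l` -/
def pv (F : Type) [Field F] {n : ℕ} (l : List (Fin n)) (T : Finset (Fin n)) (j : Fin n) : F :=
  pathSum (fun T' j' => if T' = T ∧ j' = j then (1 : F) else 0) l

theorem pathSum_congr {n : ℕ} {M : Type} [AddCommGroup M]
    (h h' : Finset (Fin n) → Fin n → M) (hh : ∀ T j, j ∉ T → h T j = h' T j)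
    (l : List (Fin n)) (hl : l.Nodup) : pathSum h l = pathSum h' l := by
  induction l with
  | nil => rfl
  | cons x xs ih =>
    rw [List.nodup_cons] at hl
    simp only [pathSum]
    rw [ih hl.2, hh _ _ (by simpa using hl.1)]

theorem map_pathSum {n : ℕ} {M N : Type} [AddCommGroup M] [AddCommGroup N] (g : M →+ N)
    (h : Finset (Fin n) → Fin n → M) (l : List (Fin n)) :
    g (pathSum h l) = pathSum (fun T j => g (h T j)) l := by
  induction l with
  | nil => simp [pathSum]
  | cons x xs ih => simp [pathSum, ih]

theorem pathSum_add {n : ℕ} {M : Type} [AddCommGroup M]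
    (h h' : Finset (Fin n) → Fin n → M) (l : List (Fin n)) :
    pathSum (fun T j => h T j + h' T j) l = pathSum h l + pathSum h' l := by
  induction l with
  | nil => simp [pathSum]
  | cons x xs ih => simp only [pathSum, ih]; abel

theorem pathSum_eq_sum (F : Type) [Field F] {n : ℕ} {M : Type} [AddCommGroup M] [Module F M]
    (h : Finset (Fin n) → Fin n → M) (l : List (Fin n)) :
    pathSum h l = ∑ x : Finset (Fin n) × Fin n, pv F l x.1 x.2 • h x.1 x.2 := by
  induction l with
  | nil => simp [pathSum, pv]
  | cons x xs ih =>
    have : ∀ T j, pv F (x :: xs) T j = (if xs.toFinset = T ∧ x = j then (1 : F) else 0)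
        + pv F xs T j := fun T j => rfl
    simp only [this, add_smul, Finset.sum_add_distrib, ← ih, pathSum]
    congr 1
    rw [Finset.sum_eq_single (xs.toFinset, x)]
    · simp
    · rintro ⟨T, j⟩ _ hne
      rw [if_neg, zero_smul]
      rintro ⟨rfl, rfl⟩
      exact hne rfl
    · simp

theorem pv_mem_zero (F : Type) [Field F] {n : ℕ} (l : List (Fin n)) (hl : l.Nodup)
    (T : Finset (Fin n)) (j : Fin n) (hj : j ∈ T) : pv F l T j = 0 := by
  unfold pv
  rw [pathSum_congr _ (fun _ _ => 0) _ l hl]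
  · clear hl
    induction l with
    | nil => rfl
    | cons x xs ih => simp [pathSum, ih]
  · rintro T' j' h
    rw [if_neg]
    rintro ⟨rfl, rfl⟩
    exact h hj

/-- the edges of the Boolean lattice up to level `k - 1` -/
abbrev Edg (n k : ℕ) : Type :=
  {x : Finset (Fin n) × Fin n // x.1.card < k - 1 ∧ x.2 ∉ x.1}

/-- the inner vertices -/
abbrev Vtx (n k : ℕ) : Type :=
  {T : Finset (Fin n) // 0 < T.card ∧ T.card < k - 1}

theorem pathSum_eq_sum_edg (F : Type) [Field F] {n : ℕ} (k : ℕ) {M : Type} [AddCommGroup M]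
    [Module F M] (h : Finset (Fin n) → Fin n → M) (l : List (Fin n)) (hl : l.Nodup)
    (h0 : ∀ T j, j ∉ T → k - 1 ≤ T.card → h T j = 0) :
    pathSum h l = ∑ e : Edg n k, pv F l e.1.1 e.1.2 • h e.1.1 e.1.2 := by
  rw [pathSum_eq_sum F h l]
  rw [← Finset.sum_subtype (Finset.univ.filter (fun x : Finset (Fin n) × Fin n =>
    x.1.card < k - 1 ∧ x.2 ∉ x.1)) (by simp) (fun x => pv F l x.1 x.2 • h x.1 x.2)]
  symm
  apply Finset.sum_subset (Finset.subset_univ _)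
  rintro ⟨T, j⟩ _ hx
  by_cases hj : j ∈ T
  · simp [pv_mem_zero F l hl T j hj]
  · rw [h0 T j hj, smul_zero]
    by_contra hc
    apply hx
    simp only [Finset.mem_filter, Finset.mem_univ, true_and]
    exact ⟨by omega, hj⟩

/-- extension by zero of a function on edges -/
def extE {F : Type} [Field F] {n k : ℕ} (h : Edg n k → F) (T : Finset (Fin n)) (j : Fin n) : F :=
  if hh : T.card < k - 1 ∧ j ∉ T then h ⟨(T, j), hh⟩ else 0

/-- extension by zero of a function on vertices -/
def extV {F : Type} [Field F] {n k : ℕ} (u : Vtx n k → F) (T : Finset (Fin n)) : F :=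
  if hh : 0 < T.card ∧ T.card < k - 1 then u ⟨T, hh⟩ else 0

/-- coboundary -/
def cob (F : Type) [Field F] (n k : ℕ) : (Vtx n k → F) →ₗ[F] (Edg n k → F) where
  toFun u e := extV u (insert e.1.2 e.1.1) - extV u e.1.1
  map_add' u v := by
    ext e
    have : ∀ T, extV (u + v) T = extV u T + extV v T := by
      intro T; unfold extV; split_ifs <;> simp
    simp only [this, Pi.add_apply]; ring
  map_smul' c u := by
    ext e
    have : ∀ T, extV (c • u) T = c * extV u T := by
      intro T; unfold extV; split_ifs <;> simp
    simp only [this, Pi.smul_apply, smul_eq_mul, RingHom.id_apply]; ring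

/-- the path incidence matrix -/
def pmat (F : Type) [Field F] (n k : ℕ) : Matrix (Equiv.Perm (Fin n)) (Edg n k) F :=
  Matrix.of fun σ e => pv F (List.ofFn σ) e.1.1 e.1.2

theorem cob_inj (F : Type) [Field F] (n k : ℕ) : Function.Injective (cob F n k) := by
  rw [injective_iff_map_eq_zero]
  intro u hu
  have key : ∀ T : Finset (Fin n), T.card ≤ k - 1 → extV u T = 0 := by
    intro T
    induction T using Finset.induction_on with
    | empty => intro _; simp [extV]
    | insert j T hj ih =>
      intro hT
      rw [Finset.card_insert_of_notMem hj] at hT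
      have h1 := ih (by omega)
      have h2 := congrFun hu ⟨(T, j), Nat.lt_of_succ_le hT, hj⟩
      simp only [cob, LinearMap.coe_mk, AddHom.coe_mk, Pi.zero_apply, h1, sub_zero] at h2
      exact h2
  ext ⟨T, hT⟩
  have := key T (by omega)
  unfold extV at this
  rw [dif_pos hT] at this
  simpa using this

theorem pathSum_append {n : ℕ} {M : Type} [AddCommGroup M]
    (h : Finset (Fin n) → Fin n → M) (c l l' : List (Fin n)) (hl : l.toFinset = l'.toFinset) :
    pathSum h (c ++ l) - pathSum h l = pathSum h (c ++ l') - pathSum h l' := by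
  induction c with
  | nil => simp
  | cons x xs ih =>
    have : (xs ++ l).toFinset = (xs ++ l').toFinset := by simp [List.toFinset_append, hl]
    simp only [List.cons_append, pathSum, this, add_sub_assoc, ih]

theorem pathSum_append_zero {n : ℕ} {M : Type} [AddCommGroup M] (m : ℕ)
    (h : Finset (Fin n) → Fin n → M) (h0 : ∀ T j, m ≤ T.card → h T j = 0)
    (c l : List (Fin n)) (hl : m ≤ l.toFinset.card) :
    pathSum h (c ++ l) = pathSum h l := by
  induction c with
  | nil => simp
  | cons x xs ih =>
    simp only [List.cons_append, pathSum, ih]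
    rw [h0, zero_add]
    refine hl.trans (Finset.card_le_card ?_)
    simp [List.toFinset_append]

theorem full_list {n : ℕ} (l : List (Fin n)) (hl : l.Nodup) (hf : l.length = n) :
    ∃ σ : Equiv.Perm (Fin n), l = List.ofFn σ := by
  have hinj : Function.Injective (fun i : Fin n => l.get (Fin.cast hf.symm i)) :=
    (List.nodup_iff_injective_get.mp hl).comp (Fin.cast_injective _)
  refine ⟨Equiv.ofBijective _ (Finite.injective_iff_bijective.mp hinj), ?_⟩
  apply List.ext_get
  · simp [hf]
  · intro i h1 h2
    simp

theorem mulVec_pmat (F : Type) [Field F] (n k : ℕ) (h : Edg n k → F) (σ : Equiv.Perm (Fin n)) :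
    (pmat F n k).mulVec h σ = pathSum (extE h) (List.ofFn σ) := by
  rw [pathSum_eq_sum_edg F k (extE h)]
  · simp only [Matrix.mulVec, dotProduct, pmat, Matrix.of_apply, smul_eq_mul]
    refine Finset.sum_congr rfl fun e _ => ?_
    unfold extE
    rw [dif_pos e.2]
  · exact List.nodup_ofFn.mpr σ.injective
  · intro T j _ hT
    unfold extE
    rw [dif_neg (by omega)]

theorem ker_pmat (F : Type) [Field F] (n k : ℕ) (hk : 2 ≤ k) (hn : k ≤ n) :
    LinearMap.ker (pmat F n k).mulVecLin = LinearMap.range (cob F n k) := by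
  ext h
  simp only [LinearMap.mem_ker, LinearMap.mem_range, Matrix.mulVecLin_apply]
  have hcard : ∀ l : List (Fin n), l.Nodup → l.toFinset.card = l.length :=
    fun l hl => List.toFinset_card_of_nodup hl
  constructor
  · intro hh
    have H : ∀ l : List (Fin n), l.Nodup → l.length = n → pathSum (extE h) l = 0 := by
      intro l h1 h2
      obtain ⟨σ, rfl⟩ := full_list l h1 h2
      rw [← mulVec_pmat, hh]; rfl
    -- completing lists
    have comp : ∀ l : List (Fin n), l.Nodup →
        pathSum (extE h) ((l.toFinsetᶜ).toList ++ l) = 0 := by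
      intro l hl
      apply H
      · rw [List.nodup_append']
        refine ⟨Finset.nodup_toList _, hl, ?_⟩
        intro x hx
        simpa using hx
      · rw [List.length_append, Finset.length_toList, ← hcard l hl, Finset.card_compl]
        have := Finset.card_le_univ l.toFinset
        simp only [Fintype.card_fin] at *
        omega
    have indep : ∀ l l' : List (Fin n), l.Nodup → l'.Nodup → l.toFinset = l'.toFinset →
        pathSum (extE h) l = pathSum (extE h) l' := by
      intro l l' h1 h2 h3
      have h4 := pathSum_append (extE h) (l.toFinsetᶜ).toList l l' h3
      rw [comp l h1] at h4
      rw [h3, comp l' h2] at h4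
      simpa using h4
    have big : ∀ l : List (Fin n), l.Nodup → k - 1 ≤ l.toFinset.card →
        pathSum (extE h) l = 0 := by
      intro l h1 h2
      rw [← comp l h1, pathSum_append_zero (k - 1) _ _ _ _ h2]
      intro T j hT
      unfold extE
      rw [dif_neg (by omega)]
    have hext : ∀ T : Finset (Fin n),
        extV (k := k) (fun T : Vtx n k => pathSum (extE h) T.1.toList) T
          = pathSum (extE h) T.toList := by
      intro T
      unfold extV
      split_ifs with hT
      · rfl
      · rcases Nat.eq_zero_or_pos T.card with h0 | h0
        · rw [Finset.card_eq_zero] at h0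
          subst h0
          simp [pathSum]
        · rw [big _ (Finset.nodup_toList _)]
          simp only [Finset.toList_toFinset]
          omega
    refine ⟨fun T => pathSum (extE h) T.1.toList, ?_⟩
    ext ⟨⟨T, j⟩, hT, hj⟩
    simp only [cob, LinearMap.coe_mk, AddHom.coe_mk, hext]
    rw [indep (insert j T).toList (j :: T.toList) (Finset.nodup_toList _)
      (by simpa [Finset.nodup_toList] using hj) (by simp)]
    simp only [pathSum, Finset.toList_toFinset, add_sub_cancel_right]
    unfold extE
    rw [dif_pos ⟨hT, hj⟩]
  · rintro ⟨u, rfl⟩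
    ext σ
    rw [mulVec_pmat]
    have key : ∀ l : List (Fin n), l.Nodup →
        pathSum (extE (cob F n k u)) l = extV u l.toFinset := by
      intro l hl
      induction l with
      | nil => simp [pathSum, extV]
      | cons x xs ih =>
        rw [List.nodup_cons] at hl
        simp only [pathSum, ih hl.2]
        have hx : x ∉ xs.toFinset := by simpa using hl.1
        rw [List.toFinset_cons]
        by_cases hc : xs.toFinset.card < k - 1
        · unfold extE
          rw [dif_pos ⟨hc, hx⟩]
          simp [cob]
        · unfold extE extV
          rw [dif_neg (by omega), dif_neg (by omega), dif_neg, zero_add]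
          rw [Finset.card_insert_of_notMem hx]; omega
    have hnd : (List.ofFn σ).Nodup := List.nodup_ofFn.mpr σ.injective
    rw [key _ hnd]
    unfold extV
    rw [dif_neg]
    · rfl
    · rw [hcard _ hnd, List.length_ofFn]; omega

theorem card_vtx (n k : ℕ) (hk : 2 ≤ k) :
    1 + Fintype.card (Vtx n k) = ∑ i ∈ Finset.range (k - 1), n.choose i := by
  have h1 : Fintype.card (Vtx n k) = ∑ i ∈ (Finset.range (k - 1)).erase 0, n.choose i := by
    rw [Fintype.card_subtype]
    rw [Finset.card_eq_sum_card_fiberwise (f := Finset.card) (t := (Finset.range (k - 1)).erase 0)]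
    · refine Finset.sum_congr rfl fun i hi => ?_
      have : (Finset.univ : Finset (Fin n)).card = n := by simp
      conv_rhs => rw [← this, ← Finset.card_powersetCard]
      congr 1
      ext T
      simp only [Finset.mem_erase, Finset.mem_range] at hi
      simp only [Finset.mem_filter, Finset.mem_univ, true_and, Finset.mem_powersetCard,
        Finset.subset_univ]
      omega
    · intro T hT
      simp at hT ⊢
      exact ⟨hT.2, Finset.nonempty_iff_ne_empty.mp (by simpa using hT.1)⟩
  rw [h1, ← Finset.add_sum_erase (Finset.range (k - 1)) _ (a := 0) (by simp; omega)]
  simp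

theorem card_edg (n k : ℕ) :
    Fintype.card (Edg n k) = ∑ i ∈ Finset.range (k - 1), n.choose i * (n - i) := by
  rw [Fintype.card_subtype]
  rw [Finset.card_eq_sum_card_fiberwise (f := fun x => x.1.card) (t := Finset.range (k - 1))]
  · refine Finset.sum_congr rfl fun i hi => ?_
    have : (Finset.univ : Finset (Fin n)).card = n := by simp
    rw [Finset.card_eq_sum_card_fiberwise (f := fun x => x.1)
      (t := Finset.powersetCard i Finset.univ)]
    · rw [Finset.sum_congr rfl (g := fun _ => n - i)]
      · simp
      · intro T hT
        rw [Finset.mem_powersetCard] at hT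
        have : n - i = (Tᶜ).card := by rw [Finset.card_compl, hT.2]; simp
        rw [this]
        refine Finset.card_bij (fun x _ => x.2) ?_ ?_ ?_
        · rintro ⟨T', j⟩ hx
          simp at hx ⊢
          rw [← hx.2]; exact hx.1.1.2
        · rintro ⟨T', j⟩ hx ⟨T'', j'⟩ hx' h
          simp at hx hx' h ⊢
          exact ⟨hx.2.trans hx'.2.symm, h⟩
        · intro j hj
          refine ⟨(T, j), ?_, rfl⟩
          simp at hj hi ⊢
          exact ⟨⟨by omega, hj⟩, hT.2⟩
    · rintro ⟨T, j⟩ hT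
      simp at hT ⊢
      exact hT.2
  · rintro ⟨T, j⟩ hT
    simp at hT ⊢
    exact hT.1

theorem rank_pmat (F : Type) [Field F] (n k : ℕ) (hk : 2 ≤ k) (hn : k ≤ n) :
    Module.finrank F (Submodule.span F (Set.range (pmat F n k).row)) =
      1 + ∑ i ∈ Finset.range (k - 1), Nat.choose n i * (n - i - 1) := by
  rw [← Matrix.rank_eq_finrank_span_row]
  have h1 := LinearMap.finrank_range_add_finrank_ker (pmat F n k).mulVecLin
  rw [ker_pmat F n k hk hn, LinearMap.finrank_range_of_inj (cob_inj F n k)] at h1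
  simp only [Module.finrank_fintype_fun_eq_card] at h1
  have h2 := card_vtx n k hk
  rw [card_edg] at h1
  have h3 : ∑ i ∈ Finset.range (k - 1), n.choose i * (n - i) =
      ∑ i ∈ Finset.range (k - 1), n.choose i * (n - i - 1)
        + ∑ i ∈ Finset.range (k - 1), n.choose i := by
    rw [← Finset.sum_add_distrib]
    refine Finset.sum_congr rfl fun i hi => ?_
    rw [Finset.mem_range] at hi
    obtain ⟨m, hm⟩ : ∃ m, n - i = m + 1 := ⟨n - i - 1, by omega⟩
    rw [hm]; simp; ring
  unfold Matrix.rank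
  omega

end Stmt8
namespace Stmt8

open Polynomial

theorem EMat_pow_apply (F : Type) [Field F] (k m : ℕ) (i j : Fin k) :
    (EMat F k ^ m) i j = if (i : ℕ) + m = j then 1 else 0 := by
  induction m generalizing j with
  | zero => simp [Matrix.one_apply, Fin.ext_iff]
  | succ m ih =>
    rw [pow_succ, Matrix.mul_apply]
    simp only [ih]
    split_ifs with h
    · rw [Finset.sum_eq_single (⟨i + m, by omega⟩ : Fin k)]
      · simp [EMat]; omega
      · intro b _ hb
        rw [if_neg, zero_mul]
        intro h'
        apply hb
        ext; exact h'.symm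
      · simp
    · refine Finset.sum_eq_zero fun b _ => ?_
      simp only [EMat, Matrix.of_apply]
      split_ifs <;> first | omega | simp

theorem aeval_E_apply (F : Type) [Field F] (k : ℕ) (p : F[X]) (i j : Fin k) :
    (aeval (EMat F k) p) i j = if (i : ℕ) ≤ j then p.coeff (j - i) else 0 := by
  induction p using Polynomial.induction_on' with
  | add p q hp hq =>
    rw [map_add, Matrix.add_apply, hp, hq]
    split_ifs <;> simp
  | monomial m a =>
    rw [aeval_monomial, ← Algebra.smul_def, Matrix.smul_apply, EMat_pow_apply, coeff_monomial]
    split_ifs <;> first | omega | simp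

/-- the structure of the elements of `A_k` -/
def IsA (F : Type) [Field F] (k : ℕ) (x : Matrix (Fin k) (Fin k) F) (p : F[X]) : Prop :=
  p.coeff 0 = 0 ∧ ∀ i j : Fin k, (i : ℕ) ≠ 0 → x i j = (aeval (EMat F k) p) i j

theorem isA_of_mem (F : Type) [Field F] (k : ℕ) (x : Matrix (Fin k) (Fin k) F)
    (hx : x ∈ AkSub F k) : ∃ p, IsA F k x p := by
  unfold AkSub at hx
  induction hx using Submodule.span_induction with
  | mem x h =>
    rcases h with (h | ⟨m, h1, h2, h⟩) | ⟨j, h1, h2, h⟩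
    · refine ⟨0, by simp, fun i j hi => ?_⟩
      rw [Set.mem_singleton_iff] at h
      simp [h, eMat, hi]
    · refine ⟨X ^ m, ?_, fun i j hi => ?_⟩
      · rw [coeff_X_pow, if_neg (by omega)]
      · simp [h]
    · refine ⟨0, by simp, fun i j hi => ?_⟩
      simp [h, eMat, hi]
  | zero => exact ⟨0, by simp, by simp⟩
  | add x y _ _ hx hy =>
    obtain ⟨p, hp, hp'⟩ := hx
    obtain ⟨q, hq, hq'⟩ := hy
    refine ⟨p + q, by simp [hp, hq], fun i j hi => ?_⟩
    rw [map_add, Matrix.add_apply, Matrix.add_apply, hp' i j hi, hq' i j hi]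
  | smul c x _ hx =>
    obtain ⟨p, hp, hp'⟩ := hx
    refine ⟨c • p, by simp [hp], fun i j hi => ?_⟩
    rw [map_smul, Matrix.smul_apply, Matrix.smul_apply, hp' i j hi]

theorem eMat_mul_apply (F : Type) [Field F] (k a b : ℕ) (hb : b < k)
    (x : Matrix (Fin k) (Fin k) F) (i j : Fin k) :
    (eMat F k a b * x) i j = if (i : ℕ) = a then x ⟨b, hb⟩ j else 0 := by
  rw [Matrix.mul_apply]
  simp only [eMat, Matrix.of_apply]
  rw [Finset.sum_eq_single (⟨b, hb⟩ : Fin k)]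
  · simp
  · intro c _ hc
    rw [if_neg, zero_mul]
    rintro ⟨_, h⟩
    exact hc (Fin.ext h)
  · simp

theorem mul_eMat_apply (F : Type) [Field F] (k a b : ℕ) (ha : a < k)
    (x : Matrix (Fin k) (Fin k) F) (i j : Fin k) :
    (x * eMat F k a b) i j = if (j : ℕ) = b then x i ⟨a, ha⟩ else 0 := by
  rw [Matrix.mul_apply]
  simp only [eMat, Matrix.of_apply]
  rw [Finset.sum_eq_single (⟨a, ha⟩ : Fin k)]
  · simp
  · intro c _ hc
    rw [if_neg, mul_zero]
    rintro ⟨h, _⟩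
    exact hc (Fin.ext h)
  · simp

theorem mul_isA (F : Type) [Field F] (k : ℕ) (hk : 0 < k) (s x : Matrix (Fin k) (Fin k) F)
    (p : F[X]) (hs : s * eMat F k 0 0 = 0) (hx : IsA F k x p) :
    s * x = s * aeval (EMat F k) p := by
  have h : x - aeval (EMat F k) p = eMat F k 0 0 * (x - aeval (EMat F k) p) := by
    ext i j
    rw [eMat_mul_apply F k 0 0 hk, Matrix.sub_apply]
    split_ifs with hi
    · have : i = ⟨0, hk⟩ := Fin.ext hi
      rw [this]; rfl
    · rw [hx.2 i j hi, sub_self]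
  rw [← sub_eq_zero, ← mul_sub, h, ← mul_assoc, hs, zero_mul]

theorem mul_prod_isA (F : Type) [Field F] (k : ℕ) (hk : 0 < k) {ι : Type}
    (x : ι → Matrix (Fin k) (Fin k) F) (p : ι → F[X]) (hx : ∀ i, IsA F k (x i) (p i))
    (l : List ι) (s : Matrix (Fin k) (Fin k) F) (hs : s * eMat F k 0 0 = 0) :
    s * (l.map x).prod = s * aeval (EMat F k) (l.map p).prod := by
  induction l generalizing s with
  | nil => simp
  | cons y ys ih =>
    rw [List.map_cons, List.prod_cons, ← mul_assoc, mul_isA F k hk s _ _ hs (hx y), ih,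
      List.map_cons, List.prod_cons, map_mul, mul_assoc]
    rw [mul_assoc]
    convert mul_zero s
    ext i j
    rw [mul_eMat_apply F k 0 0 hk, aeval_E_apply]
    simp [(hx y).1]

/-- the first row of `x` without its leading entry -/
def srow (F : Type) [Field F] (k : ℕ) (hk : 0 < k) (x : Matrix (Fin k) (Fin k) F) :
    Matrix (Fin k) (Fin k) F :=
  eMat F k 0 0 * x - x ⟨0, hk⟩ ⟨0, hk⟩ • eMat F k 0 0

theorem srow_apply (F : Type) [Field F] (k : ℕ) (hk : 0 < k) (x : Matrix (Fin k) (Fin k) F)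
    (i j : Fin k) : srow F k hk x i j =
      if (i : ℕ) = 0 ∧ (j : ℕ) ≠ 0 then x ⟨0, hk⟩ j else 0 := by
  unfold srow
  rw [Matrix.sub_apply, eMat_mul_apply F k 0 0 hk, Matrix.smul_apply]
  simp only [eMat, Matrix.of_apply]
  by_cases hi : (i : ℕ) = 0
  · by_cases hj : (j : ℕ) = 0
    · have : j = ⟨0, hk⟩ := Fin.ext hj
      simp [hi, this]
    · simp [hi, hj]
  · simp [hi]

theorem srow_mul (F : Type) [Field F] (k : ℕ) (hk : 0 < k) (x : Matrix (Fin k) (Fin k) F) :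
    srow F k hk x * eMat F k 0 0 = 0 := by
  ext i j
  rw [mul_eMat_apply F k 0 0 hk, srow_apply]
  simp

/-- the edge weights -/
noncomputable def gw (F : Type) [Field F] (k : ℕ) (hk : 0 < k) {n : ℕ}
    (x : Fin n → Matrix (Fin k) (Fin k) F) (p : Fin n → F[X])
    (T : Finset (Fin n)) (j : Fin n) : Matrix (Fin k) (Fin k) F :=
  (∏ i ∈ (insert j T)ᶜ, x i ⟨0, hk⟩ ⟨0, hk⟩) •
    (srow F k hk (x j) * aeval (EMat F k) (∏ i ∈ T, p i))

theorem row_formula (F : Type) [Field F] (k : ℕ) (hk : 0 < k) {n : ℕ}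
    (x : Fin n → Matrix (Fin k) (Fin k) F) (p : Fin n → F[X])
    (hx : ∀ i, IsA F k (x i) (p i)) (l : List (Fin n)) (hl : l.Nodup) :
    (∏ i ∈ (l.toFinset)ᶜ, x i ⟨0, hk⟩ ⟨0, hk⟩) • (eMat F k 0 0 * (l.map x).prod) =
      (∏ i, x i ⟨0, hk⟩ ⟨0, hk⟩) • eMat F k 0 0 + pathSum (gw F k hk x p) l := by
  induction l with
  | nil => simp [pathSum]
  | cons y ys ih =>
    rw [List.nodup_cons] at hl
    have hy : y ∉ ys.toFinset := by simpa using hl.1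
    have h1 : eMat F k 0 0 * x y = x y ⟨0, hk⟩ ⟨0, hk⟩ • eMat F k 0 0 + srow F k hk (x y) := by
      unfold srow; abel
    have h2 : (ys.map p).prod = ∏ i ∈ ys.toFinset, p i :=
      (List.prod_toFinset p hl.2).symm
    have h3 : (∏ i ∈ (ys.toFinset)ᶜ, x i ⟨0, hk⟩ ⟨0, hk⟩) =
        (∏ i ∈ (insert y ys.toFinset)ᶜ, x i ⟨0, hk⟩ ⟨0, hk⟩) * x y ⟨0, hk⟩ ⟨0, hk⟩ := by
      rw [Finset.compl_insert, Finset.prod_erase_mul]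
      simpa using hl.1
    rw [List.map_cons, List.prod_cons, ← mul_assoc, h1, add_mul,
      mul_prod_isA F k hk x p hx ys _ (srow_mul F k hk _), h2, smul_add, List.toFinset_cons]
    simp only [pathSum]
    rw [smul_mul_assoc, smul_smul, ← h3, ih hl.2, gw]
    abel

theorem prod_formula (F : Type) [Field F] (k : ℕ) (hk : 0 < k) {n : ℕ} (hn : k ≤ n)
    (x : Fin n → Matrix (Fin k) (Fin k) F) (p : Fin n → F[X])
    (hx : ∀ i, IsA F k (x i) (p i)) (l : List (Fin n)) (hl : l.Nodup) (hf : l.length = n) :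
    (l.map x).prod =
      (∏ i, x i ⟨0, hk⟩ ⟨0, hk⟩) • eMat F k 0 0 + pathSum (gw F k hk x p) l := by
  rw [← row_formula F k hk x p hx l hl]
  have hfull : l.toFinset = Finset.univ := by
    apply Finset.eq_univ_of_card
    rw [List.toFinset_card_of_nodup hl, hf, Fintype.card_fin]
  rw [hfull, Finset.compl_univ, Finset.prod_empty, one_smul]
  have hs : (1 - eMat F k 0 0) * eMat F k 0 0 = 0 := by
    ext i j
    rw [mul_eMat_apply F k 0 0 hk]
    simp [eMat, Matrix.one_apply, Fin.ext_iff]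
  have h1 := mul_prod_isA F k hk x p hx l _ hs
  have h2 : (l.map p).prod = ∏ i, p i := by
    rw [← hfull]; exact (List.prod_toFinset p hl).symm
  have h3 : X ^ n ∣ ∏ i, p i := by
    have : (X : F[X]) ^ n = ∏ i : Fin n, X := by simp
    rw [this]
    exact Finset.prod_dvd_prod_of_dvd _ _ fun i _ => X_dvd_iff.mpr (hx i).1
  have h4 : aeval (EMat F k) (l.map p).prod = 0 := by
    ext i j
    rw [aeval_E_apply, h2]
    split_ifs
    · exact X_pow_dvd_iff.mp h3 _ (by omega)
    · rfl
  rw [h4, mul_zero, sub_mul, one_mul, sub_eq_zero] at h1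
  exact h1

theorem gw_zero (F : Type) [Field F] (k : ℕ) (hk : 0 < k) {n : ℕ}
    (x : Fin n → Matrix (Fin k) (Fin k) F) (p : Fin n → F[X])
    (hx : ∀ i, IsA F k (x i) (p i)) (T : Finset (Fin n)) (j : Fin n) (hT : k - 1 ≤ T.card) :
    gw F k hk x p T j = 0 := by
  unfold gw
  have h3 : X ^ T.card ∣ ∏ i ∈ T, p i := by
    have : (X : F[X]) ^ T.card = ∏ i ∈ T, X := by simp
    rw [this]
    exact Finset.prod_dvd_prod_of_dvd _ _ fun i _ => X_dvd_iff.mpr (hx i).1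
  convert smul_zero _
  ext a b
  rw [Matrix.mul_apply]
  refine Finset.sum_eq_zero fun c _ => ?_
  rw [srow_apply, aeval_E_apply]
  split_ifs with h1 h2
  · rw [X_pow_dvd_iff.mp h3 _ (by omega), mul_zero]
  all_goals simp

/-- for nonempty full lists the product is a path sum -/
theorem prod_formula' (F : Type) [Field F] (k : ℕ) (hk : 2 ≤ k) {n : ℕ} (hn : k ≤ n)
    (x : Fin n → Matrix (Fin k) (Fin k) F) (p : Fin n → F[X])
    (hx : ∀ i, IsA F k (x i) (p i)) :
    ∃ G : Edg n k → Matrix (Fin k) (Fin k) F, ∀ l : List (Fin n), l.Nodup → l.length = n →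
      (l.map x).prod = ∑ e : Edg n k, pv F l e.1.1 e.1.2 • G e := by
  have hk0 : 0 < k := by omega
  let c := (∏ i, x i ⟨0, hk0⟩ ⟨0, hk0⟩) • eMat F k 0 0
  let H : Finset (Fin n) → Fin n → Matrix (Fin k) (Fin k) F :=
    fun T j => (if T = ∅ then c else 0) + gw F k hk0 x p T j
  refine ⟨fun e => H e.1.1 e.1.2, fun l hl hf => ?_⟩
  rw [← pathSum_eq_sum_edg F k H l hl, prod_formula F k hk0 hn x p hx l hl hf]
  · rw [pathSum_add]
    congr 1
    have : ∀ l : List (Fin n), l ≠ [] →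
        pathSum (fun (T : Finset (Fin n)) (_ : Fin n) => if T = ∅ then c else 0) l = c := by
      intro l hl
      induction l with
      | nil => exact absurd rfl hl
      | cons y ys ih =>
        by_cases hys : ys = []
        · subst hys; simp [pathSum]
        · simp [pathSum, ih hys, hys]
    exact (this l (by rintro rfl; simp at hf; omega)).symm
  · intro T j _ hT
    show (if T = ∅ then c else 0) + gw F k hk0 x p T j = 0
    rw [gw_zero F k hk0 x p hx T j hT, if_neg, add_zero]
    rintro rfl
    simp at hT; omega

/-- test substitution -/
def tst (F : Type) [Field F] (k : ℕ) {n : ℕ} (T : Finset (Fin n)) (j i : Fin n) :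
    Matrix (Fin k) (Fin k) F :=
  if i = j then eMat F k 0 1 else if i ∈ T then EMat F k - eMat F k 0 1 else eMat F k 0 0

theorem tst_mem (F : Type) [Field F] (k : ℕ) (hk : 2 ≤ k) {n : ℕ} (T : Finset (Fin n))
    (j i : Fin n) : tst F k T j i ∈ AkSub F k := by
  have h01 : eMat F k 0 1 ∈ AkSub F k :=
    Submodule.subset_span (Or.inr ⟨1, le_refl _, by omega, rfl⟩)
  unfold tst
  split_ifs
  · exact h01
  · rcases Nat.eq_or_lt_of_le hk with h | h
    · subst h
      convert (AkSub F 2).zero_mem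
      ext a b
      fin_cases a <;> fin_cases b <;> simp [EMat, eMat]
    · refine Submodule.sub_mem _ (Submodule.subset_span (Or.inl (Or.inr ⟨1, le_refl _, by omega, ?_⟩)))
        h01
      rw [pow_one]
  · exact Submodule.subset_span (Or.inl (Or.inl rfl))

theorem tst_formula (F : Type) [Field F] (k : ℕ) (hk : 2 ≤ k) {n : ℕ} (hn : k ≤ n)
    (e : Edg n k) (l : List (Fin n)) (hl : l.Nodup) (hf : l.length = n) :
    (l.map (tst F k e.1.1 e.1.2)).prod ⟨0, by omega⟩ ⟨e.1.1.card + 1, by have := e.2.1; omega⟩ =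
      pv F l e.1.1 e.1.2 := by
  obtain ⟨⟨T, j⟩, hT, hj⟩ := e
  have hk0 : 0 < k := by omega
  simp only at hT hj ⊢
  let p : Fin n → F[X] := fun i => if i ∈ T then X else 0
  have hp : ∀ i, IsA F k (tst F k T j i) (p i) := by
    intro i
    refine ⟨by simp only [p]; split_ifs <;> simp, fun a b ha => ?_⟩
    simp only [p, tst]
    split_ifs with h1 h2 h2
    · exact absurd (h1 ▸ h2) hj
    · simp [eMat, ha]
    · simp [eMat, ha]
    · simp [eMat, ha]
  rw [prod_formula F k hk0 hn _ p hp l hl hf]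
  have h0 : (∏ i, tst F k T j i ⟨0, hk0⟩ ⟨0, hk0⟩) = 0 := by
    apply Finset.prod_eq_zero (Finset.mem_univ j)
    simp [tst, eMat]
  rw [h0, zero_smul, zero_add]
  have hm := map_pathSum ((Matrix.entryAddMonoidHom F (⟨0, by omega⟩ : Fin k)
    (⟨T.card + 1, by omega⟩ : Fin k))) (gw F k hk0 (tst F k T j) p) l
  simp only [Matrix.entryAddMonoidHom_apply] at hm
  rw [hm]
  unfold pv
  congr 1
  funext T' j'
  unfold gw
  by_cases hj' : j' = j
  · subst hj'
    by_cases hTT : T' = T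
    · subst hTT
      rw [if_pos ⟨rfl, rfl⟩]
      have h1 : (∏ i ∈ (insert j' T')ᶜ, tst F k T' j' i ⟨0, hk0⟩ ⟨0, hk0⟩) = 1 := by
        apply Finset.prod_eq_one
        intro i hi
        simp only [Finset.mem_compl, Finset.mem_insert, not_or] at hi
        simp [tst, hi.1, hi.2, eMat]
      have h2 : ∏ i ∈ T', p i = X ^ T'.card := by
        rw [Finset.prod_congr rfl (g := fun _ => X)]
        · simp
        · intro i hi; simp [p, hi]
      have h3 : srow F k hk0 (tst F k T' j' j') = eMat F k 0 1 := by
        ext a b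
        rw [srow_apply]
        simp only [tst, eMat, Matrix.of_apply]
        by_cases ha : (a : ℕ) = 0 <;> by_cases hb : (b : ℕ) = 0 <;> simp [ha, hb]
      rw [h1, h2, h3, one_smul, eMat_mul_apply F k 0 1 (by omega), map_pow, aeval_X,
        EMat_pow_apply]
      simp [add_comm]
    · rw [if_neg (by tauto)]
      by_cases hsub : T' ⊆ T
      · obtain ⟨i, hi, hi'⟩ : ∃ i ∈ T, i ∉ T' := by
          by_contra hc
          push Not at hc
          exact hTT (hsub.antisymm hc)
        have hij : i ≠ j' := by rintro rfl; exact hj hi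
        rw [Finset.prod_eq_zero (i := i), zero_smul]
        · rfl
        · simp [hij, hi']
        · simp [tst, hij, hi, EMat, eMat]
      · obtain ⟨i, hi, hi'⟩ := Finset.not_subset.mp hsub
        rw [Finset.prod_eq_zero (s := T') (i := i) hi, map_zero, mul_zero, smul_zero]
        · rfl
        · simp [p, hi']
  · rw [if_neg (by tauto)]
    have h3 : srow F k hk0 (tst F k T j j') = 0 := by
      ext a b
      rw [srow_apply]
      simp only [tst, if_neg hj']
      split_ifs with h1 h2
      · simp [EMat, eMat]
        split_ifs <;> first | omega | simp
      · simp [eMat, h1.2]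
      · rfl
    rw [h3, zero_mul, smul_zero]
    rfl

theorem center_A (F : Type) [Field F] (k : ℕ) (hk : 2 ≤ k) (x : Matrix (Fin k) (Fin k) F)
    (hx : x ∈ AkSub F k) (hc : ∀ y ∈ AkSub F k, x * y = y * x) : x = 0 := by
  have hk0 : 0 < k := by omega
  have hk1 : 1 < k := by omega
  have h01 : eMat F k 0 1 ∈ AkSub F k :=
    Submodule.subset_span (Or.inr ⟨1, le_refl _, by omega, rfl⟩)
  have h00 : eMat F k 0 0 ∈ AkSub F k := Submodule.subset_span (Or.inl (Or.inl rfl))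
  obtain ⟨p, hp0, hp⟩ := isA_of_mem F k x hx
  have c0 : ∀ i j, _ := fun i j => congrFun (congrFun (hc _ h00) i) j
  have c1 : ∀ i j, _ := fun i j => congrFun (congrFun (hc _ h01) i) j
  simp only [mul_eMat_apply F k 0 0 hk0, eMat_mul_apply F k 0 0 hk0] at c0
  simp only [mul_eMat_apply F k 0 1 hk0, eMat_mul_apply F k 0 1 hk1] at c1
  have a0 : x ⟨0, hk0⟩ ⟨0, hk0⟩ = 0 := by
    have h := c1 ⟨0, hk0⟩ ⟨1, hk1⟩
    rw [hp ⟨1, hk1⟩ _ (by simp), aeval_E_apply] at h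
    simpa [hp0] using h
  have r0 : ∀ j, x ⟨0, hk0⟩ j = 0 := by
    intro j
    have h := c0 ⟨0, hk0⟩ j
    simp only [a0] at h
    simpa using h.symm
  have r1 : ∀ j, x ⟨1, hk1⟩ j = 0 := by
    intro j
    have h := c1 ⟨0, hk0⟩ j
    simp only [a0] at h
    simpa using h.symm
  ext i j
  rw [Matrix.zero_apply]
  by_cases hi : (i : ℕ) = 0
  · rw [← r0 j]; congr 1; exact Fin.ext hi
  · rw [hp i j hi, aeval_E_apply]
    split_ifs with h
    · have h2 := r1 ⟨j - i + 1, by omega⟩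
      rw [hp _ _ (by simp), aeval_E_apply] at h2
      simpa using h2
    · rfl

end Stmt8
namespace Stmt8

/-- substitution of matrices -/
noncomputable def sub (F : Type) [Field F] {k n : ℕ} (x : Fin n → Matrix (Fin k) (Fin k) F) :
    FA F →ₐ[F] Matrix (Fin k) (Fin k) F :=
  FreeAlgebra.lift F (Sum.elim (fun i => if h : i < n then x ⟨i, h⟩ else 0) (fun _ => 0))

theorem sub_isG (F : Type) [Field F] {k n : ℕ} (x : Fin n → Matrix (Fin k) (Fin k) F)
    (hx : ∀ i, x i ∈ AkSub F k) : IsGSubst F _ (AkSub F k) ⊥ (sub F x) := by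
  constructor
  · intro i
    simp only [sub, yv, FreeAlgebra.lift_ι_apply, Sum.elim_inl]
    split_ifs
    · exact hx _
    · exact Submodule.zero_mem _
  · intro j
    simp [sub, zv, FreeAlgebra.lift_ι_apply]

/-- monomials in the even variables -/
noncomputable def mono (F : Type) [Field F] {n : ℕ} (l : List (Fin n)) : FA F :=
  (l.map fun i => yv F i.val).prod

theorem gen_cases (F : Type) [Field F] (B : Type) [Ring B] [Algebra F B] {n : ℕ}
    (σ : Equiv.Perm (Fin n)) (w : Fin n → Bool) :
    (∀ (S : Submodule F B) (φ : FA F →ₐ[F] B), IsGSubst F B S ⊥ φ →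
      φ (List.ofFn fun i : Fin n =>
        if w (σ i) then zv F (σ i).val else yv F (σ i).val).prod = 0) ∨
    (List.ofFn fun i : Fin n =>
        if w (σ i) then zv F (σ i).val else yv F (σ i).val).prod = mono F (List.ofFn σ) := by
  by_cases h : ∃ i, w (σ i) = true
  · left
    obtain ⟨i, hi⟩ := h
    intro S φ hφ
    rw [map_list_prod]
    apply List.prod_eq_zero
    rw [List.mem_map]
    refine ⟨zv F (σ i).val, ?_, by simpa using hφ.2 (σ i).val⟩
    rw [List.mem_ofFn]
    exact ⟨i, by simp [hi]⟩
  · right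
    push Not at h
    unfold mono
    rw [List.map_ofFn]
    congr 2
    funext i
    simp [h i]

theorem map_mono (F : Type) [Field F] (B : Type) [Ring B] [Algebra F B] {n : ℕ}
    (φ : FA F →ₐ[F] B) (l : List (Fin n)) :
    φ (mono F l) = (l.map fun i => φ (yv F i.val)).prod := by
  unfold mono
  rw [map_list_prod, List.map_map]
  rfl

/-- the coordinates -/
noncomputable def Lmap (F : Type) [Field F] (n k : ℕ) (hk : 2 ≤ k) :
    FA F →ₗ[F] (Edg n k → F) :=
  LinearMap.pi fun e =>
    (Matrix.entryLinearMap F F (⟨0, by omega⟩ : Fin k)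
      (⟨e.1.1.card + 1, by have := e.2.1; omega⟩ : Fin k)).comp
      (sub F (tst F k e.1.1 e.1.2)).toLinearMap

theorem Lmap_mono (F : Type) [Field F] (n k : ℕ) (hk : 2 ≤ k) (hn : k ≤ n)
    (l : List (Fin n)) (hl : l.Nodup) (hf : l.length = n) :
    Lmap F n k hk (mono F l) = fun e => pv F l e.1.1 e.1.2 := by
  funext e
  rw [← tst_formula F k hk hn e l hl hf]
  have : (l.map fun i => sub F (tst F k e.1.1 e.1.2) (yv F i.val)) =
      l.map (tst F k e.1.1 e.1.2) := by
    apply List.map_congr_left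
    intro i _
    simp [sub, yv, FreeAlgebra.lift_ι_apply]
  simp only [Lmap, LinearMap.pi_apply, LinearMap.comp_apply, AlgHom.toLinearMap_apply, map_mono,
    this]
  rfl

theorem Lmap_id (F : Type) [Field F] (n k : ℕ) (hk : 2 ≤ k) (f : FA F)
    (hf : ∀ φ : FA F →ₐ[F] Matrix (Fin k) (Fin k) F, IsGSubst F _ (AkSub F k) ⊥ φ → φ f = 0) :
    Lmap F n k hk f = 0 := by
  funext e
  simp only [Lmap, LinearMap.pi_apply, LinearMap.comp_apply, AlgHom.toLinearMap_apply]
  rw [hf _ (sub_isG F _ fun i => tst_mem F k hk _ _ i)]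
  rfl

theorem subst_factor (F : Type) [Field F] (n k : ℕ) (hk : 2 ≤ k) (hn : k ≤ n)
    (φ : FA F →ₐ[F] Matrix (Fin k) (Fin k) F) (hφ : IsGSubst F _ (AkSub F k) ⊥ φ) :
    ∃ G : (Edg n k → F) →ₗ[F] Matrix (Fin k) (Fin k) F,
      ∀ f ∈ PnGr F n, φ f = G (Lmap F n k hk f) := by
  choose p hp using fun i : Fin n => isA_of_mem F k _ (hφ.1 i.val)
  obtain ⟨G, hG⟩ := prod_formula' F k hk hn _ p hp
  let G' : (Edg n k → F) →ₗ[F] Matrix (Fin k) (Fin k) F :=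
    ∑ e : Edg n k, (LinearMap.proj e).smulRight (G e)
  refine ⟨G', ?_⟩
  have : Set.EqOn φ.toLinearMap (G'.comp (Lmap F n k hk)) (PnGr F n) := by
    apply LinearMap.eqOn_span
    rintro m ⟨σ, w, rfl⟩
    rcases gen_cases F (Matrix (Fin k) (Fin k) F) σ w with h | h
    · rw [AlgHom.toLinearMap_apply, h _ φ hφ, LinearMap.comp_apply, Lmap_id, map_zero]
      exact h _
    · have hnd : (List.ofFn σ).Nodup := List.nodup_ofFn.mpr σ.injective
      rw [h, AlgHom.toLinearMap_apply, LinearMap.comp_apply,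
        Lmap_mono F n k hk hn _ hnd (by simp), map_mono, hG _ hnd (by simp)]
      simp [G']
  intro f hf
  exact this hf

theorem mem_Id_iff (F : Type) [Field F] (n k : ℕ) (hk : 2 ≤ k) (hn : k ≤ n) (f : FA F)
    (hf : f ∈ PnGr F n) :
    f ∈ IdGr F (Matrix (Fin k) (Fin k) F) (AkSub F k) ⊥ ↔ Lmap F n k hk f = 0 := by
  constructor
  · intro h
    exact Lmap_id F n k hk f h
  · intro h φ hφ
    obtain ⟨G, hG⟩ := subst_factor F n k hk hn φ hφ
    rw [hG f hf, h, map_zero]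

theorem map_Lmap (F : Type) [Field F] (n k : ℕ) (hk : 2 ≤ k) (hn : k ≤ n) :
    (PnGr F n).map (Lmap F n k hk) = Submodule.span F (Set.range (pmat F n k).row) := by
  have hrow : ∀ σ : Equiv.Perm (Fin n),
      Lmap F n k hk (mono F (List.ofFn σ)) = (pmat F n k).row σ := by
    intro σ
    rw [Lmap_mono F n k hk hn _ (List.nodup_ofFn.mpr σ.injective) (by simp)]
    rfl
  apply le_antisymm
  · unfold PnGr
    rw [Submodule.map_span, Submodule.span_le]
    rintro _ ⟨_, ⟨σ, w, rfl⟩, rfl⟩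
    rcases gen_cases F (Matrix (Fin k) (Fin k) F) σ w with h | h
    · rw [Lmap_id]
      · exact Submodule.zero_mem _
      · exact h _
    · rw [h, hrow]
      exact Submodule.subset_span ⟨σ, rfl⟩
  · rw [Submodule.span_le]
    rintro _ ⟨σ, rfl⟩
    refine ⟨mono F (List.ofFn σ), Submodule.subset_span ⟨σ, fun _ => false, ?_⟩, hrow σ⟩
    unfold mono
    rw [List.map_ofFn]
    rfl

theorem scodim_eq (F : Type) [Field F] {V : Type} [AddCommGroup V] [Module F V]
    (P C : Submodule F (FA F)) (L : FA F →ₗ[F] V) (h : ∀ f ∈ P, f ∈ C ↔ L f = 0) :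
    scodim F P C = Module.finrank F (P.map L) := by
  unfold scodim
  have hker : Submodule.comap P.subtype C = LinearMap.ker (L.domRestrict P) := by
    ext ⟨f, hf⟩
    simpa using h f hf
  rw [hker, (L.domRestrict P).quotKerEquivRange.finrank_eq, LinearMap.range_domRestrict]

/-- the flip along the antidiagonal -/
def flp (F : Type) [Field F] (k : ℕ) :
    Matrix (Fin k) (Fin k) F →ₗ[F] Matrix (Fin k) (Fin k) F where
  toFun x := Matrix.of fun i j => x j.rev i.rev
  map_add' _ _ := rfl
  map_smul' _ _ := rfl

theorem flp_apply (F : Type) [Field F] (k : ℕ) (x : Matrix (Fin k) (Fin k) F) (i j : Fin k) :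
    flp F k x i j = x j.rev i.rev := rfl

theorem flp_flp (F : Type) [Field F] (k : ℕ) (x : Matrix (Fin k) (Fin k) F) :
    flp F k (flp F k x) = x := by
  ext i j; simp [flp_apply]

theorem flp_mul (F : Type) [Field F] (k : ℕ) (x y : Matrix (Fin k) (Fin k) F) :
    flp F k (x * y) = flp F k y * flp F k x := by
  ext i j
  simp only [flp_apply, Matrix.of_apply, Matrix.mul_apply]
  rw [← Equiv.sum_comp Fin.revPerm]
  refine Finset.sum_congr rfl fun a _ => ?_
  simp [mul_comm]

theorem flp_one (F : Type) [Field F] (k : ℕ) : flp F k 1 = 1 := by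
  ext i j
  simp [flp_apply, Matrix.one_apply, eq_comm]

theorem flp_eMat (F : Type) [Field F] (k a b : ℕ) (ha : a < k) (hb : b < k) :
    flp F k (eMat F k a b) = eMat F k (k - 1 - b) (k - 1 - a) := by
  ext i j
  simp only [flp_apply, Matrix.of_apply, eMat, Fin.val_rev]
  have := i.isLt
  have := j.isLt
  congr 1
  apply propext
  omega

theorem flp_EMat (F : Type) [Field F] (k m : ℕ) :
    flp F k (EMat F k ^ m) = EMat F k ^ m := by
  ext i j
  simp only [flp_apply, Matrix.of_apply, EMat_pow_apply, Fin.val_rev]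
  have := i.isLt
  have := j.isLt
  congr 1
  apply propext
  omega

theorem flp_A (F : Type) [Field F] (k : ℕ) (hk : 2 ≤ k) (x : Matrix (Fin k) (Fin k) F)
    (hx : x ∈ AkSub F k) : flp F k x ∈ BkSub F k := by
  have : AkSub F k ≤ (BkSub F k).comap (flp F k) := by
    unfold AkSub
    rw [Submodule.span_le]
    rintro x ((h | ⟨m, h1, h2, h⟩) | ⟨j, h1, h2, h⟩)
    · rw [Set.mem_singleton_iff] at h
      subst h
      apply Submodule.subset_span
      left; left
      rw [Set.mem_singleton_iff, flp_eMat F k 0 0 (by omega) (by omega)]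
      rfl
    · subst h
      apply Submodule.subset_span
      exact Or.inl (Or.inr ⟨m, h1, h2, flp_EMat F k m⟩)
    · subst h
      apply Submodule.subset_span
      exact Or.inr ⟨k - 1 - j, by omega, flp_eMat F k 0 j (by omega) (by omega)⟩
  exact this hx

theorem flp_B (F : Type) [Field F] (k : ℕ) (hk : 2 ≤ k) (x : Matrix (Fin k) (Fin k) F)
    (hx : x ∈ BkSub F k) : flp F k x ∈ AkSub F k := by
  have : BkSub F k ≤ (AkSub F k).comap (flp F k) := by
    unfold BkSub
    rw [Submodule.span_le]
    rintro x ((h | ⟨m, h1, h2, h⟩) | ⟨j, h1, h⟩)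
    · rw [Set.mem_singleton_iff] at h
      subst h
      apply Submodule.subset_span
      left; left
      rw [Set.mem_singleton_iff, flp_eMat F k _ _ (by omega) (by omega)]
      simp
    · subst h
      apply Submodule.subset_span
      exact Or.inl (Or.inr ⟨m, h1, h2, flp_EMat F k m⟩)
    · subst h
      apply Submodule.subset_span
      refine Or.inr ⟨k - 1 - j, by omega, by omega, ?_⟩
      rw [flp_eMat F k j (k - 1) (by omega) (by omega)]
      simp
  exact this hx

theorem center_B (F : Type) [Field F] (k : ℕ) (hk : 2 ≤ k) (x : Matrix (Fin k) (Fin k) F)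
    (hx : x ∈ BkSub F k) (hc : ∀ y ∈ BkSub F k, x * y = y * x) : x = 0 := by
  rw [← flp_flp F k x, center_A F k hk (flp F k x) (flp_B F k hk x hx), map_zero]
  intro y hy
  have h := congrArg (flp F k) (hc _ (flp_A F k hk y hy))
  rw [flp_mul, flp_mul, flp_flp] at h
  exact h.symm

/-- reversal of words -/
noncomputable def rv (F : Type) [Field F] : FA F →ₗ[F] FA F where
  toFun f := star f
  map_add' f g := star_add f g
  map_smul' c f := by
    rw [Algebra.smul_def, star_mul, FreeAlgebra.star_algebraMap, RingHom.id_apply,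
      Algebra.smul_def, Algebra.commutes]

theorem rv_Id (F : Type) [Field F] (k : ℕ) (S S' : Submodule F (Matrix (Fin k) (Fin k) F))
    (hS : ∀ x ∈ S, flp F k x ∈ S') (f : FA F)
    (hf : f ∈ IdGr F (Matrix (Fin k) (Fin k) F) S' ⊥) :
    rv F f ∈ IdGr F (Matrix (Fin k) (Fin k) F) S ⊥ := by
  intro φ hφ
  let ψ : FA F →ₐ[F] Matrix (Fin k) (Fin k) F :=
    FreeAlgebra.lift F fun v => flp F k (φ (FreeAlgebra.ι F v))
  have hψ : ∀ g, ψ g = flp F k (φ (star g)) := by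
    intro g
    induction g using FreeAlgebra.induction with
    | grade0 c =>
      rw [FreeAlgebra.star_algebraMap, AlgHom.commutes, AlgHom.commutes, Algebra.algebraMap_eq_smul_one,
        map_smul, flp_one]
    | grade1 v => simp [ψ, FreeAlgebra.lift_ι_apply]
    | mul a b ha hb => rw [map_mul, ha, hb, star_mul, map_mul, flp_mul]
    | add a b ha hb => rw [map_add, ha, hb, star_add, map_add, map_add]
  have h1 : ψ f = 0 := by
    apply hf
    constructor
    · intro i
      rw [hψ, yv, FreeAlgebra.star_ι]
      exact hS _ (hφ.1 i)
    · intro j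
      rw [hψ, zv, FreeAlgebra.star_ι]
      have := hφ.2 j
      rw [Submodule.mem_bot] at this ⊢
      rw [zv] at this
      rw [this, map_zero]
  rw [hψ] at h1
  rw [← flp_flp F k (φ (rv F f))]
  show flp F k (flp F k (φ (star f))) = 0
  rw [h1, map_zero]

theorem rv_rv (F : Type) [Field F] (f : FA F) : rv F (rv F f) = f := star_star f

theorem star_list_prod' {R : Type} [Semiring R] [StarRing R] (l : List R) :
    star l.prod = (l.map star).reverse.prod := by
  induction l with
  | nil => simp
  | cons x xs ih => simp [ih]

theorem map_rv (F : Type) [Field F] (n : ℕ) : (PnGr F n).map (rv F) = PnGr F n := by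
  have h : (PnGr F n).map (rv F) ≤ PnGr F n := by
    conv_lhs => unfold PnGr
    rw [Submodule.map_span, Submodule.span_le]
    rintro _ ⟨_, ⟨σ, w, rfl⟩, rfl⟩
    refine Submodule.subset_span ⟨Fin.revPerm.trans σ, w, ?_⟩
    show star _ = _
    rw [star_list_prod', List.map_ofFn]
    congr 1
    apply List.ext_get
    · simp
    · intro i h1 h2
      simp at h1 h2
      have e1 : (⟨n - 1 - i, by omega⟩ : Fin n) = Fin.rev ⟨i, h1⟩ := by
        ext; simp [Fin.val_rev]; omega
      simp only [List.get_eq_getElem, List.getElem_reverse, List.length_ofFn, List.getElem_ofFn,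
        Function.comp_apply, e1, Equiv.trans_apply, Fin.revPerm_apply]
      split_ifs <;> simp [yv, zv, FreeAlgebra.star_ι]
  apply le_antisymm h
  intro f hf
  exact ⟨rv F f, h ⟨f, hf, rfl⟩, rv_rv F f⟩

theorem C_eq_Id (F : Type) [Field F] (k : ℕ) (hk : 2 ≤ k)
    (S : Submodule F (Matrix (Fin k) (Fin k) F))
    (hS : ∀ x ∈ S, (∀ y ∈ S, x * y = y * x) → x = 0) :
    CGr F (Matrix (Fin k) (Fin k) F) S ⊥ = IdGr F (Matrix (Fin k) (Fin k) F) S ⊥ := by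
  apply le_antisymm
  · rintro f ⟨_, hf⟩ φ hφ
    have := hf φ hφ
    rw [sup_bot_eq] at this
    exact hS _ this.1 this.2
  · intro f hf
    refine ⟨?_, fun φ hφ => by rw [hf φ hφ]; exact Submodule.zero_mem _⟩
    have h1 := hf ((Algebra.ofId F _).comp (constTerm F)) ⟨fun i => ?_, fun j => ?_⟩
    · have h2 := congrFun (congrFun h1 ⟨0, by omega⟩) ⟨0, by omega⟩
      simpa [Algebra.ofId_apply, Matrix.algebraMap_matrix_apply] using h2
    · simp [constTerm, yv, FreeAlgebra.lift_ι_apply]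
    · simp [constTerm, zv, FreeAlgebra.lift_ι_apply]

theorem delta_zero (F : Type) [Field F] (P C : Submodule F (FA F)) : deltaDim F P C C = 0 := by
  unfold deltaDim
  have : Submodule.comap (P ⊓ C).subtype (P ⊓ C) = ⊤ := by
    rw [Submodule.comap_subtype_self]
  rw [this]
  exact Module.finrank_zero_of_subsingleton

end Stmt8

/-- for `k ≥ 2`, the superalgebras `A_k`, `B_k` with the trivial
grading satisfy `C^gr = Id^gr`, `δ_n^{gr} = 0` for `n ≥ 1`, and
`c_n^{gr,z} = 1 + Σ_{i=0}^{k-2} C(n,i)(n-i-1)` for `n ≥ k`. -/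
theorem stmt8 (F : Type) [Field F] [CharZero F] (k : ℕ) (hk : 2 ≤ k) :
    (CGr F (Matrix (Fin k) (Fin k) F) (AkSub F k) ⊥ =
        IdGr F (Matrix (Fin k) (Fin k) F) (AkSub F k) ⊥) ∧
    (CGr F (Matrix (Fin k) (Fin k) F) (BkSub F k) ⊥ =
        IdGr F (Matrix (Fin k) (Fin k) F) (BkSub F k) ⊥) ∧
    (∀ n : ℕ, 1 ≤ n →
      deltaDim F (PnGr F n) (CGr F (Matrix (Fin k) (Fin k) F) (AkSub F k) ⊥)
          (IdGr F (Matrix (Fin k) (Fin k) F) (AkSub F k) ⊥) = 0 ∧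
      deltaDim F (PnGr F n) (CGr F (Matrix (Fin k) (Fin k) F) (BkSub F k) ⊥)
          (IdGr F (Matrix (Fin k) (Fin k) F) (BkSub F k) ⊥) = 0) ∧
    (∀ n : ℕ, k ≤ n →
      scodim F (PnGr F n) (CGr F (Matrix (Fin k) (Fin k) F) (AkSub F k) ⊥) =
          1 + ∑ i ∈ Finset.range (k - 1), Nat.choose n i * (n - i - 1) ∧
      scodim F (PnGr F n) (CGr F (Matrix (Fin k) (Fin k) F) (BkSub F k) ⊥) =
          1 + ∑ i ∈ Finset.range (k - 1), Nat.choose n i * (n - i - 1)) := by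
  have hA := Stmt8.C_eq_Id F k hk (AkSub F k) (Stmt8.center_A F k hk)
  have hB := Stmt8.C_eq_Id F k hk (BkSub F k) (Stmt8.center_B F k hk)
  refine ⟨hA, hB, fun n _ => ?_, fun n hn => ?_⟩
  · rw [hA, hB]
    exact ⟨Stmt8.delta_zero F _ _, Stmt8.delta_zero F _ _⟩
  · rw [hA, hB]
    constructor
    · rw [Stmt8.scodim_eq F _ _ (Stmt8.Lmap F n k hk) (Stmt8.mem_Id_iff F n k hk hn),
        Stmt8.map_Lmap F n k hk hn, Stmt8.rank_pmat F n k hk hn]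
    · rw [Stmt8.scodim_eq F _ _ ((Stmt8.Lmap F n k hk).comp (Stmt8.rv F)), Submodule.map_comp,
        Stmt8.map_rv, Stmt8.map_Lmap F n k hk hn, Stmt8.rank_pmat F n k hk hn]
      intro f hf
      have hf' : Stmt8.rv F f ∈ PnGr F n := by
        rw [← Stmt8.map_rv F n]
        exact ⟨f, hf, rfl⟩
      rw [LinearMap.comp_apply, ← Stmt8.mem_Id_iff F n k hk hn _ hf']
      constructor
      · exact Stmt8.rv_Id F k _ _ (Stmt8.flp_A F k hk) f
      · intro h
        have := Stmt8.rv_Id F k _ _ (Stmt8.flp_B F k hk) _ h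
        rwa [Stmt8.rv_rv] at this
end

section
/- For every k ≥ 3, C^gr(N_k^{gr}) = Id^gr(N_{k−1}^{gr}), where N_k^{gr} and N_{k−1}^{gr} denote N_k and N_{k−1} equipped with the elementary ℤ₂-grading induced by (0,1,…,1). -/
open Polynomial in
/-- entries of the model matrix -/
noncomputable def thE {F : Type} [Field F] (r m : F[X]) (a b : ℕ) : F :=
  if a = 0 then (if b = 0 then r.coeff 0 else m.coeff (b - 1))
  else (if a ≤ b then r.coeff (b - a) else 0)

open Polynomial in
/-- the model matrix attached to a pair of polynomials -/
noncomputable def Th {F : Type} [Field F] (k : ℕ) (r m : F[X]) : Matrix (Fin k) (Fin k) F :=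
  Matrix.of fun a b => thE r m a b

open Polynomial in
theorem Th_apply {F : Type} [Field F] (k : ℕ) (r m : F[X]) (a b : Fin k) :
    Th k r m a b = thE r m a b := rfl

open Polynomial in
theorem Th_add {F : Type} [Field F] (k : ℕ) (r m r' m' : F[X]) :
    Th k r m + Th k r' m' = Th k (r + r') (m + m') := by
  ext a b
  simp only [Matrix.add_apply, Th_apply, thE]
  split_ifs <;> simp

open Polynomial in
theorem Th_smul {F : Type} [Field F] (k : ℕ) (c : F) (r m : F[X]) :
    c • Th k r m = Th k (c • r) (c • m) := by
  ext a b
  simp only [Matrix.smul_apply, Th_apply, thE]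
  split_ifs <;> simp

open Polynomial in
theorem Th_zero {F : Type} [Field F] (k : ℕ) : Th k (0 : F[X]) 0 = 0 := by
  ext a b
  simp [Th_apply, thE]

open Polynomial in
theorem Th_C {F : Type} [Field F] (k : ℕ) (c : F) :
    Th k (C c) 0 = algebraMap F (Matrix (Fin k) (Fin k) F) c := by
  ext a b
  rw [Matrix.algebraMap_matrix_apply]
  simp only [Th_apply, thE, coeff_C, Fin.ext_iff, Algebra.algebraMap_self, RingHom.id_apply, coeff_zero]
  split_ifs <;> first | rfl | omega | simp_all

open Polynomial in
theorem conv_sum {F : Type} [Field F] (p q : F[X]) (k a b : ℕ) (hab : a ≤ b) (hb : b < k) :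
    ∑ c ∈ Finset.range k, (if a ≤ c ∧ c ≤ b then p.coeff (c - a) * q.coeff (b - c) else 0)
      = (p * q).coeff (b - a) := by
  rw [coeff_mul, Finset.Nat.sum_antidiagonal_eq_sum_range_succ (fun i j => p.coeff i * q.coeff j),
    ← Finset.sum_filter]
  have : (Finset.range k).filter (fun c => a ≤ c ∧ c ≤ b) = Finset.Ico a (b + 1) := by
    ext c; simp; omega
  rw [this, Finset.sum_Ico_eq_sum_range, show b + 1 - a = (b - a).succ by omega]
  refine Finset.sum_congr rfl fun i hi => ?_
  rw [show a + i - a = i by omega, show b - (a + i) = b - a - i by omega]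

open Polynomial in
theorem Th_mul {F : Type} [Field F] (k : ℕ) (r m r' m' : F[X]) :
    Th k r m * Th k r' m' = Th k (r * r') (C (r.coeff 0) * m' + m * r') := by
  ext a b
  rw [Matrix.mul_apply]
  simp only [Th_apply]
  rw [Fin.sum_univ_eq_sum_range (fun c => thE r m a c * thE r' m' c b) k]
  obtain ⟨a, ha⟩ := a
  obtain ⟨b, hb⟩ := b
  dsimp only
  by_cases ha0 : a = 0
  · subst ha0
    by_cases hb0 : b = 0
    · subst hb0
      rw [Finset.sum_eq_single 0]
      · simp [thE, mul_coeff_zero]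
      · intro c _ hc; simp [thE, hc]
      · intro h; simp at h; omega
    · have h1 : ∀ c ∈ Finset.range k, thE r m 0 c * thE r' m' c b =
          (if c = 0 then r.coeff 0 * m'.coeff (b - 1) else 0) +
          (if 1 ≤ c ∧ c ≤ b then m.coeff (c - 1) * r'.coeff (b - c) else 0) := by
        intro c _
        by_cases hc : c = 0
        · subst hc; simp [thE, hb0]
        · have : 1 ≤ c := by omega
          by_cases h2 : c ≤ b <;> simp [thE, hc, this, h2]
      rw [Finset.sum_congr rfl h1, Finset.sum_add_distrib, conv_sum _ _ _ _ _ (by omega) hb]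
      rw [Finset.sum_ite_eq' ]
      simp [thE, hb0, ha]
  · by_cases hab : a ≤ b
    · have h1 : ∀ c ∈ Finset.range k, thE r m a c * thE r' m' c b =
          (if a ≤ c ∧ c ≤ b then r.coeff (c - a) * r'.coeff (b - c) else 0) := by
        intro c _
        by_cases hc : a ≤ c
        · have : c ≠ 0 := by omega
          by_cases h2 : c ≤ b <;> simp [thE, ha0, hc, this, h2]
        · simp [thE, ha0, hc]
      rw [Finset.sum_congr rfl h1, conv_sum _ _ _ _ _ hab hb]
      simp [thE, ha0, hab]
    · rw [Finset.sum_eq_zero]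
      · simp [thE, ha0, hab]
      · intro c _
        by_cases hc : a ≤ c
        · have : c ≠ 0 := by omega
          have h2 : ¬ c ≤ b := by omega
          simp [thE, this, h2]
        · simp [thE, ha0, hc]

open Polynomial in
theorem eMat_eq_Th (F : Type) [Field F] (k j : ℕ) (hj : 1 ≤ j) :
    eMat F k 0 j = Th k 0 (X ^ (j - 1)) := by
  ext a b
  simp only [eMat, Matrix.of_apply, Th_apply, thE, coeff_X_pow, coeff_zero]
  split_ifs <;> first | rfl | omega | simp_all

open Polynomial in
theorem EMat_pow_eq_Th (F : Type) [Field F] (k n : ℕ) :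
    EMat F k ^ (n + 1) = Th k (X ^ (n + 1)) (X ^ n) := by
  induction n with
  | zero =>
    ext a b
    simp only [zero_add, pow_one, pow_zero, EMat, Matrix.of_apply, Th_apply, thE, coeff_X, coeff_one]
    split_ifs <;> first | rfl | omega | simp_all
  | succ n ih =>
    have h1 : EMat F k = Th k X 1 := by
      ext a b
      simp only [EMat, Matrix.of_apply, Th_apply, thE, coeff_X, coeff_one]
      split_ifs <;> first | rfl | omega | simp_all
    rw [pow_succ, ih, h1, Th_mul]
    congr 1
    simp [pow_succ]

open Polynomial in
theorem Nk_exists {F : Type} [Field F] {k : ℕ} {x : Matrix (Fin k) (Fin k) F}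
    (hx : x ∈ NkSub F k) : ∃ r m : F[X], x = Th k r m := by
  unfold NkSub at hx
  induction hx using Submodule.span_induction with
  | mem x h =>
    rcases h with (h | ⟨n, h1, h2, rfl⟩) | ⟨j, h1, h2, rfl⟩
    · refine ⟨C 1, 0, ?_⟩
      rw [Th_C, map_one]; exact h
    · obtain ⟨n, rfl⟩ : ∃ n', n = n' + 1 := ⟨n - 1, by omega⟩
      exact ⟨_, _, EMat_pow_eq_Th F k n⟩
    · exact ⟨_, _, eMat_eq_Th F k j h1⟩
  | zero => exact ⟨0, 0, (Th_zero k).symm⟩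
  | add x y _ _ hx hy =>
    obtain ⟨r, m, rfl⟩ := hx
    obtain ⟨r', m', rfl⟩ := hy
    exact ⟨_, _, Th_add _ _ _ _ _⟩
  | smul c x _ hx =>
    obtain ⟨r, m, rfl⟩ := hx
    exact ⟨_, _, Th_smul _ _ _ _⟩

open Polynomial in
theorem even_exists {F : Type} [Field F] {k : ℕ} {x : Matrix (Fin k) (Fin k) F}
    (hx : x ∈ NkSub F k ⊓ matEvenPart F k) : ∃ r : F[X], x = Th k r 0 := by
  obtain ⟨h1, h2⟩ := hx
  obtain ⟨r, m, rfl⟩ := Nk_exists h1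
  refine ⟨r, ?_⟩
  ext a b
  by_cases h : ((a : ℕ) = 0) ↔ ¬((b : ℕ) = 0)
  · rw [h2 a b h]
    simp only [Th_apply, thE, coeff_zero]
    split_ifs <;> first | rfl | omega | simp_all
  · simp only [Th_apply, thE]
    split_ifs <;> first | rfl | omega | simp_all

open Polynomial in
theorem odd_exists {F : Type} [Field F] {k : ℕ} {x : Matrix (Fin k) (Fin k) F}
    (hx : x ∈ NkSub F k ⊓ matOddPart F k) : ∃ m : F[X], x = Th k 0 m := by
  obtain ⟨h1, h2⟩ := hx
  obtain ⟨r, m, rfl⟩ := Nk_exists h1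
  refine ⟨m, ?_⟩
  ext a b
  by_cases h : ((a : ℕ) = 0) ↔ ((b : ℕ) = 0)
  · rw [h2 a b h]
    simp only [Th_apply, thE, coeff_zero]
    split_ifs <;> first | rfl | omega | simp_all
  · simp only [Th_apply, thE, coeff_zero]
    split_ifs <;> first | rfl | omega | simp_all

open Polynomial in
theorem odd_mem {F : Type} [Field F] (k : ℕ) (m : F[X]) :
    Th k 0 m ∈ NkSub F k ⊓ matOddPart F k := by
  refine ⟨?_, ?_⟩
  · induction m using Polynomial.induction_on' with
    | add p q hp hq =>
      have := Th_add k 0 p 0 q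
      rw [add_zero] at this
      rw [← this]; exact add_mem hp hq
    | monomial n c =>
      have h : Th k 0 (monomial n c) = c • Th k 0 (X ^ n) := by
        rw [Th_smul, smul_zero, smul_X_eq_monomial]
      rw [h]
      refine Submodule.smul_mem _ _ ?_
      by_cases hn : n + 1 ≤ k - 1
      · refine Submodule.subset_span (Or.inr ⟨n + 1, by omega, hn, ?_⟩)
        rw [eMat_eq_Th _ _ _ (by omega)]; simp
      · have : Th k 0 (X ^ n : F[X]) = 0 := by
          ext a b
          simp only [Th_apply, thE, coeff_X_pow, coeff_zero, Matrix.zero_apply]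
          split_ifs <;> first | rfl | omega | simp_all
        rw [this]; exact zero_mem _
  · intro a b h
    simp only [Th_apply, thE, coeff_zero]
    split_ifs <;> first | rfl | omega | simp_all

open Polynomial in
theorem even_mem {F : Type} [Field F] (k : ℕ) (r : F[X]) :
    Th k r 0 ∈ NkSub F k ⊓ matEvenPart F k := by
  refine ⟨?_, ?_⟩
  · induction r using Polynomial.induction_on' with
    | add p q hp hq =>
      have := Th_add k p 0 q 0
      rw [add_zero] at this
      rw [← this]; exact add_mem hp hq
    | monomial n c =>
      have h : Th k (monomial n c) 0 = c • Th k (X ^ n) 0 := by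
        rw [Th_smul, smul_zero, smul_X_eq_monomial]
      rw [h]
      refine Submodule.smul_mem _ _ ?_
      rcases n with _ | n
      · refine Submodule.subset_span (Or.inl (Or.inl ?_))
        have := Th_C k (1 : F)
        simpa using this
      by_cases hn : n + 1 ≤ k - 2
      · have h2 : Th k (X ^ (n + 1)) (X ^ n) ∈ NkSub F k :=
          Submodule.subset_span (Or.inl (Or.inr ⟨n + 1, by omega, hn, (EMat_pow_eq_Th F k n).symm⟩))
        have h3 := (odd_mem k (X ^ n : F[X])).1
        have h4 := Th_add k (X ^ (n + 1)) 0 0 (X ^ n : F[X])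
        rw [add_zero, zero_add] at h4
        rw [← h4] at h2
        simpa using sub_mem h2 h3
      · have : Th k (X ^ (n + 1) : F[X]) 0 = 0 := by
          ext a b
          simp only [Th_apply, thE, coeff_X_pow, coeff_zero, Matrix.zero_apply]
          split_ifs <;> first | rfl | omega | simp_all
        rw [this]; exact zero_mem _
  · intro a b h
    simp only [Th_apply, thE, coeff_zero]
    split_ifs <;> first | rfl | omega | simp_all

open Polynomial in
/-- evaluation of the even variables at `r`, odd variables at zero -/
noncomputable def psiA {F : Type} [Field F] {A : Type} [CommRing A] [Algebra F A] (r : ℕ → A) : FA F →ₐ[F] A :=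
  FreeAlgebra.lift F (Sum.elim r (fun _ => 0))

open Polynomial in
/-- the matrix substitution attached to polynomials -/
noncomputable def phiK {F : Type} [Field F] (k : ℕ) (r m : ℕ → F[X]) : FA F →ₐ[F] Matrix (Fin k) (Fin k) F :=
  FreeAlgebra.lift F (Sum.elim (fun i => Th k (r i) 0) (fun j => Th k 0 (m j)))

open Polynomial in
theorem phiK_subst {F : Type} [Field F] (k : ℕ) (r m : ℕ → F[X]) :
    IsGSubst F (Matrix (Fin k) (Fin k) F)
        (NkSub F k ⊓ matEvenPart F k) (NkSub F k ⊓ matOddPart F k) (phiK k r m) := by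
  constructor
  · intro i
    simpa [phiK, yv] using even_mem k (r i)
  · intro i
    simpa [phiK, zv] using odd_mem k (m i)

open Polynomial in
theorem subst_exists {F : Type} [Field F] (k : ℕ) (φ : FA F →ₐ[F] Matrix (Fin k) (Fin k) F)
    (h : IsGSubst F (Matrix (Fin k) (Fin k) F)
        (NkSub F k ⊓ matEvenPart F k) (NkSub F k ⊓ matOddPart F k) φ) :
    ∃ r m : ℕ → F[X], φ = phiK k r m := by
  choose r hr using fun i => even_exists (h.1 i)
  choose m hm using fun i => odd_exists (h.2 i)
  refine ⟨r, m, ?_⟩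
  apply FreeAlgebra.hom_ext
  funext v
  rcases v with i | i
  · simpa [phiK, yv] using hr i
  · simpa [phiK, zv] using hm i

open Polynomial in
theorem phiK_eq {F : Type} [Field F] (r m : ℕ → F[X]) (f : FA F) :
    ∃ M : F[X], ∀ k, phiK k r m f = Th k (psiA r f) M := by
  induction f using FreeAlgebra.induction with
  | grade0 c =>
    refine ⟨0, fun k => ?_⟩
    rw [AlgHom.commutes, AlgHom.commutes, ← Th_C]; rfl
  | grade1 v =>
    rcases v with i | i
    · exact ⟨0, fun k => by simp [phiK, psiA]⟩
    · exact ⟨m i, fun k => by simp [phiK, psiA]⟩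
  | mul a b ha hb =>
    obtain ⟨M, hM⟩ := ha
    obtain ⟨M', hM'⟩ := hb
    exact ⟨_, fun k => by rw [map_mul, map_mul, hM, hM', Th_mul]⟩
  | add a b ha hb =>
    obtain ⟨M, hM⟩ := ha
    obtain ⟨M', hM'⟩ := hb
    exact ⟨_, fun k => by rw [map_add, map_add, hM, hM', Th_add]⟩

theorem psiA_comp {F : Type} [Field F] {A B : Type} [CommRing A] [Algebra F A]
    [CommRing B] [Algebra F B] (g : A →ₐ[F] B) (r : ℕ → A) (f : FA F) :
    g (psiA r f) = psiA (fun i => g (r i)) f := by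
  have : g.comp (psiA r) = psiA (fun i => g (r i)) := by
    apply FreeAlgebra.hom_ext
    funext v
    rcases v with i | i <;> simp [psiA]
  rw [← this]; rfl

theorem constTerm_eq {F : Type} [Field F] (f : FA F) :
    constTerm F f = psiA (fun _ => (0 : F)) f := by
  unfold constTerm psiA
  congr 2
  funext v
  rcases v with i | i <;> rfl

open Polynomial in
theorem psi_zero {F : Type} [Field F] [CharZero F] (f : FA F)
    (h : ∀ a : ℕ → F, psiA a f = 0) (r : ℕ → F[X]) : psiA r f = 0 := by
  apply Polynomial.funext
  intro s
  have := psiA_comp (Polynomial.aeval s) r f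
  rw [h] at this
  simpa [Polynomial.coe_aeval_eq_eval] using this

open Polynomial in
theorem scalar_zero {F : Type} [Field F] [CharZero F] (k : ℕ) (hk : 3 ≤ k) (f : FA F)
    (h0 : constTerm F f = 0)
    (h : ∀ φ, IsGSubst F (Matrix (Fin k) (Fin k) F)
        (NkSub F k ⊓ matEvenPart F k) (NkSub F k ⊓ matOddPart F k) φ →
      φ f ∈ centerIn F _ ((NkSub F k ⊓ matEvenPart F k) ⊔ (NkSub F k ⊓ matOddPart F k)))
    (a : ℕ → F) : psiA a f = 0 := by
  set q : F[X] := psiA (fun i => C (a i) * X) f with hq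
  have hd : derivative q = 0 := by
    apply Polynomial.funext
    intro s
    have h1 := psiA_comp (Polynomial.aeval (X + C s : F[X])) (fun i => C (a i) * X) f
    rw [← hq] at h1
    set r : ℕ → F[X] := fun i => Polynomial.aeval (X + C s : F[X]) (C (a i) * X) with hr
    obtain ⟨M, hM⟩ := phiK_eq r 0 f
    have h2 := (h _ (phiK_subst k r 0)).2 (Th k 0 1) (Submodule.mem_sup_right (odd_mem k 1))
    rw [hM, Th_mul, Th_mul] at h2
    have h3 := congrFun (congrFun h2 ⟨0, by omega⟩) ⟨2, by omega⟩
    simp only [Th_apply, thE] at h3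
    simp at h3
    rw [← h1] at h3
    have h4 := taylor_coeff_one s q
    have h6 : (Polynomial.aeval (X + C s : F[X])) q = taylor s q := rfl
    rw [h6, h4] at h3
    rw [← h3, eval_zero]
  have h5 := derivative_eq_zero.1 hd
  have h6 := eq_C_of_natDegree_eq_zero h5
  have e0 := psiA_comp (Polynomial.aeval (0 : F)) (fun i => C (a i) * X) f
  have e1 := psiA_comp (Polynomial.aeval (1 : F)) (fun i => C (a i) * X) f
  rw [← hq, h6] at e0 e1
  simp at e0 e1
  rw [constTerm_eq] at h0
  rw [← e1, e0, h0]

open Polynomial in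
theorem stmt9_aux1 {F : Type} [Field F] [CharZero F] (k : ℕ) (hk : 3 ≤ k) (f : FA F)
    (h0 : constTerm F f = 0)
    (h : ∀ φ, IsGSubst F (Matrix (Fin k) (Fin k) F)
        (NkSub F k ⊓ matEvenPart F k) (NkSub F k ⊓ matOddPart F k) φ →
      φ f ∈ centerIn F _ ((NkSub F k ⊓ matEvenPart F k) ⊔ (NkSub F k ⊓ matOddPart F k)))
    (r m : ℕ → F[X]) : phiK (k - 1) r m f = 0 := by
  have hz := psi_zero f (scalar_zero k hk f h0 h) r
  obtain ⟨M, hM⟩ := phiK_eq r m f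
  have h2 := (h _ (phiK_subst k r m)).2 (Th k X 0) (Submodule.mem_sup_left (even_mem k X))
  rw [hM, hz, Th_mul, Th_mul] at h2
  rw [hM, hz]
  ext a b
  simp only [Th_apply, thE, coeff_zero, Matrix.zero_apply]
  by_cases ha : (a : ℕ) = 0
  · by_cases hb : (b : ℕ) = 0
    · simp [ha, hb]
    · have h3 := congrFun (congrFun h2 ⟨0, by omega⟩) ⟨b + 1, by omega⟩
      simp only [Th_apply, thE] at h3
      obtain ⟨b', hb'⟩ : ∃ b', (b : ℕ) = b' + 1 := ⟨b - 1, by omega⟩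
      simp [hb'] at h3
      simp [ha, hb', h3]
  · simp [ha]

open Polynomial in
theorem stmt9_aux2 {F : Type} [Field F] [CharZero F] (k : ℕ) (hk : 3 ≤ k) (f : FA F)
    (h : ∀ r m : ℕ → F[X], phiK (k - 1) r m f = 0) :
    constTerm F f = 0 ∧ ∀ r m : ℕ → F[X], phiK k r m f ∈
      centerIn F _ ((NkSub F k ⊓ matEvenPart F k) ⊔ (NkSub F k ⊓ matOddPart F k)) := by
  have hs : ∀ a : ℕ → F, psiA a f = 0 := by
    intro a
    have h1 := h (fun i => C (a i)) 0
    obtain ⟨M, hM⟩ := phiK_eq (fun i => C (a i)) 0 f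
    rw [hM] at h1
    have h3 := congrFun (congrFun h1 ⟨0, by omega⟩) ⟨0, by omega⟩
    have h4 := psiA_comp (Polynomial.aeval (0 : F)) (fun i => C (a i)) f
    simp only [Th_apply, thE] at h3
    simp at h3
    simp [h3, ← coeff_zero_eq_aeval_zero] at h4
    exact h4.symm
  refine ⟨by rw [constTerm_eq, hs], fun r m => ?_⟩
  have hz := psi_zero f hs r
  have h1 := h r m
  obtain ⟨M, hM⟩ := phiK_eq r m f
  rw [hM, hz] at h1
  rw [hM, hz]
  have hc : ∀ j, j < k - 2 → M.coeff j = 0 := by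
    intro j hj
    have h3 := congrFun (congrFun h1 ⟨0, by omega⟩) ⟨j + 1, by omega⟩
    simpa [Th_apply, thE] using h3
  refine ⟨Submodule.mem_sup_right (odd_mem k M), fun y hy => ?_⟩
  have hy' : y ∈ NkSub F k := (sup_le inf_le_left inf_le_left : _ ≤ NkSub F k) hy
  obtain ⟨r', m', rfl⟩ := Nk_exists hy'
  rw [Th_mul, Th_mul]
  ext a b
  simp only [Th_apply, thE]
  by_cases ha : (a : ℕ) = 0
  · by_cases hb : (b : ℕ) = 0
    · simp [ha, hb]
    · simp only [ha, hb, if_true, if_false]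
      simp only [coeff_zero, C_0, zero_mul, zero_add, mul_zero, add_zero, coeff_C_mul]
      rw [coeff_mul, Finset.sum_eq_single ((b : ℕ) - 1, 0)]
      · ring
      · rintro ⟨i, j⟩ hij hne
        rw [Finset.HasAntidiagonal.mem_antidiagonal] at hij
        dsimp only at hij ⊢
        have : i ≠ b - 1 := by
          rintro rfl
          apply hne
          rw [Prod.mk.injEq]; omega
        rw [hc i (by omega), zero_mul]
      · intro hh; simp at hh
  · simp [ha]

/-- for `k ≥ 3`, `C^gr(N_k^{gr}) = Id^gr(N_{k-1}^{gr})`, where the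
grading is the elementary ℤ₂-grading induced by `(0,1,…,1)`. -/
theorem stmt9 (F : Type) [Field F] [CharZero F] (k : ℕ) (hk : 3 ≤ k) :
    CGr F (Matrix (Fin k) (Fin k) F)
        (NkSub F k ⊓ matEvenPart F k) (NkSub F k ⊓ matOddPart F k) =
      IdGr F (Matrix (Fin (k - 1)) (Fin (k - 1)) F)
        (NkSub F (k - 1) ⊓ matEvenPart F (k - 1))
        (NkSub F (k - 1) ⊓ matOddPart F (k - 1)) := by
  ext f
  constructor
  · rintro ⟨h0, h⟩ φ hφ
    obtain ⟨r, m, rfl⟩ := subst_exists _ φ hφ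
    exact stmt9_aux1 k hk f h0 h r m
  · intro h
    obtain ⟨h0, h1⟩ := stmt9_aux2 k hk f (fun r m => h _ (phiK_subst _ r m))
    refine ⟨h0, fun φ hφ => ?_⟩
    obtain ⟨r, m, rfl⟩ := subst_exists _ φ hφ
    exact h1 r m
end
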